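/- arXiv:2412.13792 — 3 statements merged into one kernel-verified Lean document; each statement's English description precedes it below -/
import Mathlib

section
/- Let G be an F6-free graph with m edges, where m ≥ 88. Then the spectral radius of G satisfies λ(G) ≤ (1+√(4m−3))/2. -/
open SimpleGraph Finset
open scoped Classical

/-- The spectral radius of a finite simple graph: the largest eigenvalue of its
adjacency matrix (expressed as the supremum of the set of eigenvalues). -/
noncomputable def specRad {V : Type*} [Fintype V] (G : SimpleGraph V) : ℝ :=
  sSup {t : ℝ | Module.End.HasEigenvalue (Matrix.toLin' (G.adjMatrix ℝ)) t}

/-- The fan graph `F₆ = K₁ ∨ P₅`: the path `0-1-2-3-4` together with the hub `5`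
adjacent to all of `0,…,4`. -/
def fan6 : SimpleGraph (Fin 6) :=
  SimpleGraph.fromRel (fun a b => b = 5 ∨ (b.val = a.val + 1 ∧ b.val ≤ 4))

/-- A graph is `F₆`-free if it contains no subgraph isomorphic to the fan `F₆`,
i.e. there is no injective graph homomorphism from `F₆` into it. -/
def F6Free {V : Type*} (G : SimpleGraph V) : Prop :=
  ¬ ∃ f : fan6 →g G, Function.Injective f

/-- The join `K₂ ∨ kK₁`: two adjacent vertices, each adjacent to `k` further
pairwise non-adjacent vertices. -/
def K2JoinEmpty (k : ℕ) : SimpleGraph (Fin 2 ⊕ Fin k) :=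
  SimpleGraph.fromRel (fun a b => a.isLeft ∨ b.isLeft)

/-- `dS G S v` is the number of neighbors of `v` lying in `S`. -/
noncomputable def dS {V : Type*} (G : SimpleGraph V) (S : Set V) (v : V) : ℕ :=
  (G.neighborSet v ∩ S).ncard

/-- `eIn G S` is the number of edges of the induced subgraph `G[S]`. -/
noncomputable def eIn {V : Type*} (G : SimpleGraph V) (S : Set V) : ℕ :=
  {e ∈ G.edgeSet | ∀ v ∈ e, v ∈ S}.ncard

/-- `eBetween G S T` is the number of edges with one endpoint in `S` and the
other in `T`. -/
noncomputable def eBetween {V : Type*} (G : SimpleGraph V) (S T : Set V) : ℕ :=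
  {e ∈ G.edgeSet | ∃ a ∈ S, ∃ b ∈ T, e = s(a, b)}.ncard

/-- `gamma G x ustar S = Σ_{u∈S} (d_S(u) - 1)·x_u/x_{u*} - e(S)`. -/
noncomputable def gamma {V : Type*} [Fintype V] (G : SimpleGraph V) (x : V → ℝ)
    (ustar : V) (S : Set V) : ℝ :=
  (∑ u ∈ S.toFinset, ((dS G S u : ℝ) - 1) * (x u / x ustar)) - eIn G S

/-- The star `K_{1,r}` with center `0` and `r` leaves. -/
def starGraph (r : ℕ) : SimpleGraph (Fin (r + 1)) :=
  SimpleGraph.fromRel (fun a _ => a = 0)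

/-- `K_{1,r} + e`: the star with center `0` and `r` leaves, plus an edge joining
the two leaves `1` and `2`. -/
def starPlusEdge (r : ℕ) : SimpleGraph (Fin (r + 1)) :=
  SimpleGraph.fromRel (fun a b => a = 0 ∨ (a = 1 ∧ b = 2))

/-- The double star `D_{a,b}`: centers `0` and `1` joined by an edge, `0` joined
to the `a` leaves `2,…,a+1`, and `1` joined to the `b` leaves `a+2,…,a+b+1`. -/
def doubleStar (a b : ℕ) : SimpleGraph (Fin (a + b + 2)) :=
  SimpleGraph.fromRel (fun u v =>
    (u.val = 0 ∧ v.val = 1) ∨ (u.val = 0 ∧ 2 ≤ v.val ∧ v.val < a + 2) ∨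
      (u.val = 1 ∧ a + 2 ≤ v.val))

/-- `K₄ - e`: the complete graph on 4 vertices minus the edge `{0,1}`. -/
def K4MinusE : SimpleGraph (Fin 4) :=
  SimpleGraph.fromRel (fun u v => ¬(u = 0 ∧ v = 1) ∧ ¬(u = 1 ∧ v = 0))

/-- `H` contains no path on five vertices (not necessarily induced). -/
def PathFiveFree {V : Type*} (H : SimpleGraph V) : Prop :=
  ∀ ⦃a b c d e : V⦄, H.Adj a b → H.Adj b c → H.Adj c d → H.Adj d e →
    a ≠ c → a ≠ d → a ≠ e → b ≠ d → b ≠ e → c ≠ e → False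

theorem SimpleGraph.Reachable.mem_of_closed {V : Type*} {H : SimpleGraph V} {T : Set V}
    (hT : ∀ u ∈ T, ∀ v, H.Adj u v → v ∈ T) {a v : V} (h : H.Reachable a v) (ha : a ∈ T) :
    v ∈ T := by
  obtain ⟨p⟩ := h
  induction p with
  | nil => exact ha
  | cons hadj _ ih => exact ih (hT _ ha _ hadj)

theorem supp_subset_of_closed {V : Type*} {H : SimpleGraph V} (C : H.ConnectedComponent)
    {T : Set V} (hT : ∀ u ∈ T, ∀ v, H.Adj u v → v ∈ T) {a : V} (ha : a ∈ T) (haC : a ∈ C.supp) :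
    C.supp ⊆ T :=
  fun _ hv => (C.reachable_of_mem_supp haC hv).mem_of_closed hT ha

theorem mem_supp_of_adj {V : Type*} {H : SimpleGraph V} {C : H.ConnectedComponent} {a b : V}
    (h : H.Adj a b) (ha : a ∈ C.supp) : b ∈ C.supp :=
  C.mem_supp_of_adj_mem_supp ha h

theorem PathFiveFree.exists_short_cycle {V : Type*} {H : SimpleGraph V} (hP : PathFiveFree H)
    {u : V} {q : H.Walk u u} (hq : q.IsCycle) :
    (∃ b c, H.Adj u b ∧ H.Adj b c ∧ H.Adj c u) ∨
      ∃ b c d, H.Adj u b ∧ H.Adj b c ∧ H.Adj c d ∧ H.Adj d u ∧ u ≠ c ∧ b ≠ d := by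
  have hl := hq.three_le_length
  have hadj : ∀ i, i < q.length → H.Adj (q.getVert i) (q.getVert (i + 1)) :=
    fun i hi => q.adj_getVert_succ hi
  have hne : ∀ i j, i < j → j < q.length → q.getVert i ≠ q.getVert j := fun i j hij hj h =>
    hij.ne (hq.getVert_injOn' (by simp; omega) (by simp; omega) h)
  have h0 : q.getVert 0 = u := q.getVert_zero
  have hlast : q.getVert q.length = u := q.getVert_length
  have a0 := hadj 0 (by omega)
  have a1 := hadj 1 (by omega)
  have a2 := hadj 2 (by omega)
  rcases Nat.lt_or_ge 3 q.length with h3 | h3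
  · have a3 := hadj 3 h3
    rcases Nat.lt_or_ge 4 q.length with h4 | h4
    · exact (hP a0 a1 a2 a3 (hne _ _ (by omega) (by omega)) (hne _ _ (by omega) (by omega))
        (hne _ _ (by omega) (by omega)) (hne _ _ (by omega) (by omega))
        (hne _ _ (by omega) (by omega)) (hne _ _ (by omega) (by omega))).elim
    · have h5 : q.length = 3 + 1 := by omega
      have n1 := hne 0 2 (by omega) (by omega)
      have n2 := hne 1 3 (by omega) (by omega)
      rw [← h5, hlast] at a3
      rw [h0] at a0 n1
      exact Or.inr ⟨_, _, _, a0, a1, a2, a3, n1, n2⟩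
  · have h5 : q.length = 2 + 1 := by omega
    rw [← h5, hlast] at a2
    rw [h0] at a0
    exact Or.inl ⟨_, _, a0, a1, a2⟩

/-- In a component without triangles and four-cycles of a `P₅`-free graph, the degree sum is the
one of a tree. -/
theorem PathFiveFree.sum_degree_add_two {V : Type*} [Fintype V] {H : SimpleGraph V}
    (hP : PathFiveFree H) (C : H.ConnectedComponent)
    (h3 : ∀ a b c, a ∈ C.supp → H.Adj a b → H.Adj b c → H.Adj c a → False)
    (h4 : ∀ a b c d, a ∈ C.supp → H.Adj a b → H.Adj b c → H.Adj c d → H.Adj d a →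
      a ≠ c → b ≠ d → False) :
    ∑ v ∈ C.supp.toFinset, H.degree v + 2 = 2 * C.supp.toFinset.card := by
  have htree : C.toSimpleGraph.IsTree := by
    refine ⟨C.connected_toSimpleGraph, ?_⟩
    intro u p hp
    have hp' : (p.map C.toSimpleGraph_hom).IsCycle := hp.map Subtype.val_injective
    have hu : C.toSimpleGraph_hom u ∈ C.supp := u.2
    rcases hP.exists_short_cycle hp' with ⟨b, c, h⟩ | ⟨b, c, d, h⟩
    · exact h3 _ b c hu h.1 h.2.1 h.2.2
    · exact h4 _ b c d hu h.1 h.2.1 h.2.2.1 h.2.2.2.1 h.2.2.2.2.1 h.2.2.2.2.2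
  have h1 := htree.card_edgeFinset
  have h2 := C.toSimpleGraph.sum_degrees_eq_twice_card_edges
  have h5 : ∑ v ∈ C.supp.toFinset, H.degree v = ∑ v : C, C.toSimpleGraph.degree v := by
    rw [Finset.sum_subtype (p := fun v => v ∈ C.supp) _ (by simp)]
    refine Finset.sum_congr rfl fun v _ => ?_
    rw [← SimpleGraph.card_neighborFinset_eq_degree, ← SimpleGraph.card_neighborFinset_eq_degree]
    refine (Finset.card_bij (fun a _ => a.1) ?_ ?_ ?_).symm
    · intro a ha
      rw [SimpleGraph.mem_neighborFinset] at ha ⊢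
      exact ha
    · intro a _ b _ h
      exact Subtype.ext h
    · intro b hb
      have hb' : H.Adj v b := by simpa using hb
      exact ⟨⟨b, mem_supp_of_adj hb' v.2⟩, by rw [SimpleGraph.mem_neighborFinset]; exact hb', rfl⟩
  have h6 : C.supp.toFinset.card = Fintype.card C := by
    rw [Set.toFinset_card]
    exact Fintype.card_congr (Equiv.refl _)
  rw [h5, h2, h6]
  omega

theorem PathFiveFree.supp_eq_of_four_cycle {V : Type*} {H : SimpleGraph V}
    (hP : PathFiveFree H) {C : H.ConnectedComponent} {a b c d : V} (ha : a ∈ C.supp)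
    (hab : H.Adj a b) (hbc : H.Adj b c) (hcd : H.Adj c d) (hda : H.Adj d a)
    (hac : a ≠ c) (hbd : b ≠ d) : C.supp = {a, b, c, d} := by
  apply Set.Subset.antisymm
  · refine supp_subset_of_closed C (a := a) ?_ (by simp) ha
    have key : ∀ a b c d v, H.Adj a b → H.Adj b c → H.Adj c d → H.Adj d a → a ≠ c → b ≠ d →
        H.Adj a v → v ∈ ({a, b, c, d} : Set V) := by
      intro a b c d v hab hbc hcd hda hac hbd hav
      by_contra hv
      simp only [Set.mem_insert_iff, Set.mem_singleton_iff, not_or] at hv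
      exact hP hav.symm hab hbc hcd hv.2.1 hv.2.2.1 hv.2.2.2 hac hda.ne' hbd
    rintro u (rfl | rfl | rfl | rfl) v huv
    · exact key _ _ _ _ _ hab hbc hcd hda hac hbd huv
    · have := key _ _ _ _ _ hbc hcd hda hab hbd hac.symm huv
      simp only [Set.mem_insert_iff, Set.mem_singleton_iff] at this ⊢
      tauto
    · have := key _ _ _ _ _ hcd hda hab hbc hac.symm hbd.symm huv
      simp only [Set.mem_insert_iff, Set.mem_singleton_iff] at this ⊢
      tauto
    · have := key _ _ _ _ _ hda hab hbc hcd hbd.symm hac huv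
      simp only [Set.mem_insert_iff, Set.mem_singleton_iff] at this ⊢
      tauto
  · have hb := mem_supp_of_adj hab ha
    have hc := mem_supp_of_adj hbc hb
    have hd := mem_supp_of_adj hcd hc
    rintro u (rfl | rfl | rfl | rfl) <;> assumption

theorem supp_eq_of_isolated_triangle {V : Type*} {H : SimpleGraph V}
    {C : H.ConnectedComponent} {a b c : V} (ha : a ∈ C.supp)
    (hab : H.Adj a b) (hca : H.Adj c a)
    (h : ∀ u ∈ ({a, b, c} : Set V), ∀ v, H.Adj u v → v ∈ ({a, b, c} : Set V)) :
    C.supp = {a, b, c} := by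
  apply Set.Subset.antisymm
  · exact supp_subset_of_closed C (a := a) h (by simp) ha
  · have hb := mem_supp_of_adj hab ha
    have hc := mem_supp_of_adj hca.symm ha
    rintro u (rfl | rfl | rfl) <;> assumption

/-- A triangle `abc` with a pendant vertex `l` at `a`, in a component without four-cycles of a
`P₅`-free graph, forces the component to be a star centred at `a` with the extra edge `bc`. -/
theorem PathFiveFree.star_of_pendant_triangle {V : Type*} {H : SimpleGraph V}
    (hP : PathFiveFree H) {C : H.ConnectedComponent} {a b c l : V} (ha : a ∈ C.supp)
    (hab : H.Adj a b) (hbc : H.Adj b c) (hca : H.Adj c a)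
    (hal : H.Adj a l) (hlb : l ≠ b) (hlc : l ≠ c)
    (h4 : ∀ a b c d, a ∈ C.supp → H.Adj a b → H.Adj b c → H.Adj c d → H.Adj d a →
      a ≠ c → b ≠ d → False) :
    (∀ v, v ∈ C.supp ↔ v = a ∨ H.Adj a v) ∧
      (∀ v, H.Adj a v → v ≠ b → v ≠ c → ∀ y, H.Adj v y → y = a) ∧
      (∀ y, H.Adj b y → y = a ∨ y = c) ∧ ∀ y, H.Adj c y → y = a ∨ y = b := by
  have hbase : ∀ b c, H.Adj a b → H.Adj b c → H.Adj c a → l ≠ b → l ≠ c →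
      ∀ y, H.Adj b y → y = a ∨ y = c := by
    intro b c hab hbc hca hlb hlc y hby
    by_contra! hy
    by_cases hay : H.Adj a y
    · exact h4 a y b c ha hay hby.symm hbc hca hab.ne hy.2
    · refine hP hal.symm hca.symm hbc.symm hby hlc hlb ?_ hab.ne hy.1.symm hy.2.symm
      rintro rfl
      exact hay hal
  have hb := hbase b c hab hbc hca hlb hlc
  have hc := hbase c b hca.symm hbc.symm hab.symm hlc hlb
  have hleaf : ∀ v, H.Adj a v → v ≠ b → v ≠ c → ∀ y, H.Adj v y → y = a := by
    intro v hav hvb hvc y hvy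
    by_contra hya
    have hyb : y ≠ b := by
      rintro rfl
      rcases hb v hvy.symm with h | h
      · exact hav.ne' h
      · exact hvc h
    have hyc : y ≠ c := by
      rintro rfl
      rcases hc v hvy.symm with h | h
      · exact hav.ne' h
      · exact hvb h
    exact hP hvy.symm hav.symm hab hbc hya hyb hyc hvb hvc hca.ne'
  refine ⟨fun v => ⟨fun hv => ?_, ?_⟩, hleaf, hb, hc⟩
  · refine supp_subset_of_closed C (T := {v | v = a ∨ H.Adj a v}) (a := a) ?_ (Or.inl rfl) ha hv
    rintro u (rfl | hu) v huv
    · exact Or.inr huv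
    · by_cases hub : u = b
      · subst hub
        rcases hb v huv with rfl | rfl
        · exact Or.inl rfl
        · exact Or.inr hca.symm
      · by_cases huc : u = c
        · subst huc
          rcases hc v huv with rfl | rfl
          · exact Or.inl rfl
          · exact Or.inr hab
        · exact Or.inl (hleaf u hu hub huc v huv)
  · rintro (rfl | h)
    · exact ha
    · exact mem_supp_of_adj h ha

theorem F6Free.false_of_fan {V : Type*} {G : SimpleGraph V} (hG : F6Free G) {z a b c d e : V}
    (hza : G.Adj z a) (hzb : G.Adj z b) (hzc : G.Adj z c) (hzd : G.Adj z d) (hze : G.Adj z e)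
    (hab : G.Adj a b) (hbc : G.Adj b c) (hcd : G.Adj c d) (hde : G.Adj d e)
    (h1 : a ≠ c) (h2 : a ≠ d) (h3 : a ≠ e) (h4 : b ≠ d) (h5 : b ≠ e) (h6 : c ≠ e) : False := by
  have := hab.ne
  have := hbc.ne
  have := hcd.ne
  have := hde.ne
  have := hza.ne
  have := hzb.ne
  have := hzc.ne
  have := hzd.ne
  have := hze.ne
  refine hG ⟨⟨![a, b, c, d, e, z], ?_⟩, ?_⟩
  · intro i j hij
    fin_cases i <;> fin_cases j <;> simp [fan6] at hij ⊢ <;>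
      first | assumption | (apply SimpleGraph.Adj.symm; assumption)
  · intro i j hij
    fin_cases i <;> fin_cases j <;> simp at hij ⊢ <;> grind

/-- The graph on `V` whose edges are the edges of `G` inside the neighbourhood of `z`. -/
def linkGraph {V : Type*} (G : SimpleGraph V) (z : V) : SimpleGraph V where
  Adj u v := G.Adj u v ∧ G.Adj z u ∧ G.Adj z v
  symm := ⟨fun _ _ h => ⟨h.1.symm, h.2.2, h.2.1⟩⟩
  loopless := ⟨fun _ h => h.1.ne rfl⟩

theorem F6Free.pathFiveFree_linkGraph {V : Type*} {G : SimpleGraph V} (hG : F6Free G) (z : V) :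
    PathFiveFree (linkGraph G z) :=
  fun _ _ _ _ _ hab hbc hcd hde h1 h2 h3 h4 h5 h6 =>
    hG.false_of_fan hab.2.1 hab.2.2 hbc.2.2 hcd.2.2 hde.2.2 hab.1 hbc.1 hcd.1 hde.1
      h1 h2 h3 h4 h5 h6

section Perron

/-- The indicator of adjacency, as a real number. -/
noncomputable def ind {V : Type*} (G : SimpleGraph V) (u v : V) : ℝ :=
  if G.Adj u v then 1 else 0

variable {V : Type*} {G : SimpleGraph V} {z : V} {x : V → ℝ} {r : ℝ}

theorem ind_of_adj {u v : V} (h : G.Adj u v) : ind G u v = 1 := if_pos h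

theorem ind_of_not_adj {u v : V} (h : ¬ G.Adj u v) : ind G u v = 0 := if_neg h

theorem ind_nonneg (u v : V) : 0 ≤ ind G u v := by
  unfold ind; split_ifs <;> norm_num

theorem ind_le_one (u v : V) : ind G u v ≤ 1 := by
  unfold ind; split_ifs <;> norm_num

theorem ind_comm (u v : V) : ind G u v = ind G v u := by
  unfold ind; simp only [G.adj_comm]

theorem sum_four {f : V → ℝ} {a b c d : V} (hab : a ≠ b) (hac : a ≠ c) (had : a ≠ d)
    (hbc : b ≠ c) (hbd : b ≠ d) (hcd : c ≠ d) :
    ∑ u ∈ ({a, b, c, d} : Finset V), f u = f a + f b + f c + f d := by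
  rw [Finset.sum_insert (by simp [hab, hac, had]), Finset.sum_insert (by simp [hbc, hbd]),
    Finset.sum_pair hcd]
  ring

theorem sum_three {f : V → ℝ} {a b c : V} (hab : a ≠ b) (hac : a ≠ c) (hbc : b ≠ c) :
    ∑ u ∈ ({a, b, c} : Finset V), f u = f a + f b + f c := by
  rw [Finset.sum_insert (by simp [hab, hac]), Finset.sum_pair hbc]
  ring

/-- The vertices at distance at least two from `z`. -/
noncomputable def far {V : Type*} [Fintype V] (G : SimpleGraph V) (z : V) : Finset V :=
  univ.filter fun w => w ≠ z ∧ ¬ G.Adj z w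

/-- The number of neighbours of `u` in `far G z`. -/
noncomputable def outDeg {V : Type*} [Fintype V] (G : SimpleGraph V) (z u : V) : ℝ :=
  ∑ w ∈ far G z, ind G u w

/-- The loss at `u` from neighbours in `far G z` whose weight is below one. -/
noncomputable def cost {V : Type*} [Fintype V] (G : SimpleGraph V) (z : V) (x : V → ℝ) (u : V) :
    ℝ :=
  ∑ w ∈ far G z, ind G u w * (1 - x w)

/-- The contribution of `u` to `gamma` of the neighbourhood of `z`, where each edge is split
evenly between its endpoints. -/
noncomputable def excess {V : Type*} [Fintype V] (G : SimpleGraph V) (z : V) (x : V → ℝ) (u : V) :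
    ℝ :=
  (((linkGraph G z).degree u : ℝ) - 1) * x u - ((linkGraph G z).degree u : ℝ) / 2

/-- The weight of the vertices of `S` not adjacent to `w`. -/
noncomputable def missing {V : Type*} (G : SimpleGraph V) (x : V → ℝ) (S : Finset V) (w : V) : ℝ :=
  ∑ u ∈ S, (1 - ind G w u) * x u

/-- `x` is a nonnegative eigenvector of an `F₆`-free graph for the eigenvalue `r`, with maximal
entry `1` at the vertex `z`. -/
structure PerronData {V : Type*} [Fintype V] (G : SimpleGraph V) (z : V) (x : V → ℝ) (r : ℝ) :
    Prop where
  free : F6Free G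
  nonneg : ∀ v, 0 ≤ x v
  le_one : ∀ v, x v ≤ 1
  root : x z = 1
  eig : ∀ v, r * x v = ∑ u, ind G v u * x u
  large : 9.8 ≤ r

variable [Fintype V]

theorem mem_far {w : V} : w ∈ far G z ↔ w ≠ z ∧ ¬ G.Adj z w := by
  simp [far]

theorem outDeg_nonneg (u : V) : 0 ≤ outDeg G z u :=
  Finset.sum_nonneg fun _ _ => ind_nonneg _ _

/-- Splitting a sum over all vertices by the distance to `z`. -/
theorem sum_split (f : V → ℝ) :
    ∑ u, f u = f z + ∑ u ∈ G.neighborFinset z, f u + ∑ w ∈ far G z, f w := by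
  have h1 : (univ : Finset V) = insert z (G.neighborFinset z ∪ far G z) := by
    ext v
    simp only [mem_univ, mem_insert, mem_union, SimpleGraph.mem_neighborFinset, mem_far, true_iff]
    tauto
  have h2 : Disjoint (G.neighborFinset z) (far G z) := by
    rw [Finset.disjoint_left]
    intro v hv hv'
    rw [SimpleGraph.mem_neighborFinset] at hv
    exact (mem_far.1 hv').2 hv
  have h3 : z ∉ G.neighborFinset z ∪ far G z := by
    simp [mem_far]
  rw [h1, Finset.sum_insert h3, Finset.sum_union h2, add_assoc]

theorem sum_link_neighborFinset {u : V} (hu : G.Adj z u) (f : V → ℝ) :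
    ∑ v ∈ (linkGraph G z).neighborFinset u, f v =
      ∑ v ∈ G.neighborFinset z, ind G u v * f v := by
  have h : (linkGraph G z).neighborFinset u =
      (G.neighborFinset z).filter fun v => G.Adj u v := by
    ext v
    rw [SimpleGraph.mem_neighborFinset, Finset.mem_filter, SimpleGraph.mem_neighborFinset]
    exact ⟨fun h => ⟨h.2.2, h.1⟩, fun h => ⟨h.2, hu, h.1⟩⟩
  rw [h, Finset.sum_filter]
  refine Finset.sum_congr rfl fun v _ => ?_
  unfold ind
  split_ifs <;> simp

namespace PerronData

theorem cost_nonneg (h : PerronData G z x r) (u : V) : 0 ≤ cost G z x u :=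
  Finset.sum_nonneg fun w _ => mul_nonneg (ind_nonneg _ _) (by linarith [h.le_one w])

theorem r_eq (h : PerronData G z x r) : r = ∑ u ∈ G.neighborFinset z, x u := by
  have h1 := h.eig z
  rw [sum_split (G := G) (z := z), h.root, ind_of_not_adj G.irrefl] at h1
  have h2 : ∑ w ∈ far G z, ind G z w * x w = 0 :=
    Finset.sum_eq_zero fun w hw => by rw [ind_of_not_adj (mem_far.1 hw).2, zero_mul]
  have h3 : ∑ u ∈ G.neighborFinset z, ind G z u * x u = ∑ u ∈ G.neighborFinset z, x u :=
    Finset.sum_congr rfl fun u hu => by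
      rw [ind_of_adj ((G.mem_neighborFinset _ _).1 hu), one_mul]
  rw [h2, h3] at h1
  linarith

theorem eig_neighbor (h : PerronData G z x r) {u : V} (hu : G.Adj z u) :
    r * x u = 1 + ∑ v ∈ (linkGraph G z).neighborFinset u, x v + outDeg G z u - cost G z x u := by
  have h1 : outDeg G z u - cost G z x u = ∑ w ∈ far G z, ind G u w * x w := by
    rw [outDeg, cost, ← Finset.sum_sub_distrib]
    exact Finset.sum_congr rfl fun w _ => by ring
  rw [h.eig u, sum_split (G := G) (z := z), h.root, ind_of_adj hu.symm,
    sum_link_neighborFinset hu, add_sub_assoc, h1, one_mul]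

theorem missing_le (h : PerronData G z x r) {S : Finset V} (hS : S ⊆ G.neighborFinset z) {w : V}
    (hw : w ∈ far G z) : missing G x S w ≤ r * (1 - x w) + outDeg G z w := by
  have h1 : missing G x S w ≤ missing G x (G.neighborFinset z) w :=
    Finset.sum_le_sum_of_subset_of_nonneg hS fun u _ _ =>
      mul_nonneg (by linarith [ind_le_one (G := G) w u]) (h.nonneg u)
  have h2 := h.eig w
  rw [sum_split (G := G) (z := z), ind_of_not_adj fun hz => (mem_far.1 hw).2 hz.symm] at h2
  have h3 : ∑ v ∈ far G z, ind G w v * x v ≤ outDeg G z w :=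
    Finset.sum_le_sum fun v _ => mul_le_of_le_one_right (ind_nonneg _ _) (h.le_one v)
  have h4 : missing G x (G.neighborFinset z) w =
      r - ∑ u ∈ G.neighborFinset z, ind G w u * x u := by
    rw [h.r_eq, ← Finset.sum_sub_distrib]
    exact Finset.sum_congr rfl fun u _ => by ring
  linarith

theorem cost_lower (h : PerronData G z x r) {S : Finset V} (hS : S ⊆ G.neighborFinset z)
    (hout : ∀ w ∈ far G z, outDeg G z w = 0) (E : Finset V) {q : ℝ} (hq : 0 ≤ q) (u : V)
    (hmiss : ∀ w ∈ far G z, w ∉ E → G.Adj u w → q ≤ missing G x S w) :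
    q * (outDeg G z u - E.card) ≤ r * cost G z x u := by
  have h1 : r * cost G z x u + q * ∑ w ∈ far G z, (if w ∈ E then 1 else 0) ≥
      q * outDeg G z u := by
    rw [cost, outDeg, Finset.mul_sum, Finset.mul_sum, Finset.mul_sum, ← Finset.sum_add_distrib]
    refine Finset.sum_le_sum fun w hw => ?_
    have h2 := h.missing_le hS hw
    rw [hout w hw] at h2
    have h3 := mul_nonneg (show 0 ≤ r by linarith [h.large]) (sub_nonneg.2 (h.le_one w))
    by_cases huw : G.Adj u w
    · rw [ind_of_adj huw]
      split_ifs with hE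
      · linarith
      · linarith [hmiss w hw hE huw]
    · rw [ind_of_not_adj huw]
      split_ifs <;> linarith
  have h2 : ∑ w ∈ far G z, (if w ∈ E then (1 : ℝ) else 0) ≤ E.card := by
    rw [Finset.sum_ite_mem, Finset.sum_const, nsmul_eq_mul, mul_one]
    exact_mod_cast Finset.card_le_card Finset.inter_subset_right
  nlinarith [mul_le_mul_of_nonneg_left h2 hq]

theorem degree_three (h : PerronData G z x r) {u a b c : V} (hu : G.Adj z u)
    (hN : (linkGraph G z).neighborFinset u = {a, b, c}) (hab : a ≠ b) (hac : a ≠ c)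
    (hbc : b ≠ c) :
    excess G z x u = 2 * x u - 3 / 2 ∧ r * x u ≤ 1 + x a + x b + x c + outDeg G z u := by
  have h1 := h.eig_neighbor hu
  have h2 := h.cost_nonneg u
  have h3 : (linkGraph G z).degree u = 3 := by
    rw [← SimpleGraph.card_neighborFinset_eq_degree, hN, Finset.card_eq_three]
    exact ⟨a, b, c, hab, hac, hbc, rfl⟩
  rw [hN, Finset.sum_insert (by simp [hab, hac]), Finset.sum_pair hbc] at h1
  rw [excess, h3]
  push_cast
  constructor <;> linarith

theorem degree_two (h : PerronData G z x r) {u a b : V} (hu : G.Adj z u)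
    (hN : (linkGraph G z).neighborFinset u = {a, b}) (hab : a ≠ b) :
    excess G z x u = x u - 1 ∧ r * x u ≤ 1 + x a + x b + outDeg G z u ∧
      1 + x a + x b ≤ r * x u := by
  have h1 := h.eig_neighbor hu
  have h2 := h.cost_nonneg u
  have h3 : (linkGraph G z).degree u = 2 := by
    rw [← SimpleGraph.card_neighborFinset_eq_degree, hN, Finset.card_pair hab]
  have h4 : cost G z x u ≤ outDeg G z u :=
    Finset.sum_le_sum fun w _ =>
      mul_le_of_le_one_right (ind_nonneg _ _) (by linarith [h.nonneg w])
  rw [hN, Finset.sum_pair hab] at h1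
  rw [excess, h3]
  push_cast
  refine ⟨?_, ?_, ?_⟩ <;> linarith

end PerronData

/-- The estimates satisfied by each component of the graph induced on the neighbourhood of `z`. -/
def Piece (G : SimpleGraph V) (z : V) (x : V → ℝ) (r : ℝ) (S : Finset V) : Prop :=
  ∑ u ∈ S, excess G z x u ≤ -1 ∨
  (∃ u, S = {u} ∧ ∑ u ∈ S, excess G z x u = -x u) ∨
  (S.card ≤ 4 ∧ (∀ w ∈ far G z, ∑ u ∈ S, excess G z x u + 1 ≤ missing G x S w) ∧
    (-1 < ∑ u ∈ S, excess G z x u → r ≤ ∑ u ∈ S, outDeg G z u)) ∨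
  (∑ u ∈ S, excess G z x u ≤ 0 ∧ ((∀ w ∈ far G z, outDeg G z w = 0) →
    ∑ u ∈ S, excess G z x u + 1 ≤ ∑ u ∈ S, cost G z x u))

namespace PerronData

theorem piece_K4 (h : PerronData G z x r) {a b c d : V}
    (hab : (linkGraph G z).Adj a b) (hac : (linkGraph G z).Adj a c)
    (had : (linkGraph G z).Adj a d) (hbc : (linkGraph G z).Adj b c)
    (hbd : (linkGraph G z).Adj b d) (hcd : (linkGraph G z).Adj c d)
    (hNa : (linkGraph G z).neighborFinset a = {b, c, d})
    (hNb : (linkGraph G z).neighborFinset b = {a, c, d})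
    (hNc : (linkGraph G z).neighborFinset c = {a, b, d})
    (hNd : (linkGraph G z).neighborFinset d = {a, b, c}) :
    Piece G z x r {a, b, c, d} := by
  obtain ⟨ea, ra⟩ := h.degree_three hab.2.1 hNa hbc.ne hbd.ne hcd.ne
  obtain ⟨eb, rb⟩ := h.degree_three hab.2.2 hNb hac.ne had.ne hcd.ne
  obtain ⟨ec, rc⟩ := h.degree_three hac.2.2 hNc hab.ne had.ne hbd.ne
  obtain ⟨ed, rd⟩ := h.degree_three had.2.2 hNd hab.ne hac.ne hbc.ne
  have one : ∀ {a b c d w : V}, (linkGraph G z).Adj a b → (linkGraph G z).Adj a c →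
      (linkGraph G z).Adj a d → (linkGraph G z).Adj b c →
      (linkGraph G z).Adj b d → (linkGraph G z).Adj c d → w ∈ far G z →
      G.Adj w a → G.Adj w b → False := by
    intro a b c d w hab hac had hbc hbd hcd hw hwa hwb
    obtain ⟨hwz, hzw⟩ := mem_far.1 hw
    refine h.free.false_of_fan (z := a) (a := w) (b := b) (c := c) (d := d) (e := z) hwa.symm
      hab.1 hac.1 had.1 hab.2.1.symm hwb hbc.1 hcd.1 had.2.2.symm ?_ ?_ hwz hbd.ne
      hab.2.2.ne' hac.2.2.ne' <;> rintro rfl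
    · exact hzw hac.2.2
    · exact hzw had.2.2
  have xa := h.le_one a
  have xb := h.le_one b
  have xc := h.le_one c
  have xd := h.le_one d
  have hr := h.large
  unfold Piece missing
  simp only [sum_four hab.ne hac.ne had.ne hbc.ne hbd.ne hcd.ne, ea, eb, ec, ed]
  refine Or.inr (Or.inr (Or.inl ⟨Finset.card_le_four, fun w hw => ?_, fun hlt => ?_⟩))
  · have nab := one hab hac had hbc hbd hcd hw
    have nac := one hac hab had hbc.symm hcd hbd hw
    have nad := one had hab hac hbd.symm hcd.symm hbc hw
    have nbc := one hbc hab.symm hbd hac.symm hcd had hw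
    have nbd := one hbd hab.symm hbc had.symm hcd.symm hac hw
    have ncd := one hcd hac.symm hbc.symm had.symm hbd.symm hab hw
    unfold ind
    split_ifs <;> first | linarith | (exfalso; tauto)
  · nlinarith

theorem piece_K4_minus_edge (h : PerronData G z x r) {a b c d : V}
    (hab : (linkGraph G z).Adj a b) (hac : (linkGraph G z).Adj a c)
    (had : (linkGraph G z).Adj a d) (hbc : (linkGraph G z).Adj b c)
    (hbd : (linkGraph G z).Adj b d) (hcd : c ≠ d)
    (hNa : (linkGraph G z).neighborFinset a = {b, c, d})
    (hNb : (linkGraph G z).neighborFinset b = {a, c, d})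
    (hNc : (linkGraph G z).neighborFinset c = {a, b})
    (hNd : (linkGraph G z).neighborFinset d = {a, b}) :
    Piece G z x r {a, b, c, d} := by
  obtain ⟨ea, ra⟩ := h.degree_three hab.2.1 hNa hbc.ne hbd.ne hcd
  obtain ⟨eb, rb⟩ := h.degree_three hab.2.2 hNb hac.ne had.ne hcd
  obtain ⟨ec, rc, rc'⟩ := h.degree_two hac.2.2 hNc hab.ne
  obtain ⟨ed, rd, rd'⟩ := h.degree_two had.2.2 hNd hab.ne
  have mid : ∀ {a b c d w : V}, (linkGraph G z).Adj a b → (linkGraph G z).Adj a c →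
      (linkGraph G z).Adj a d → (linkGraph G z).Adj b c →
      (linkGraph G z).Adj b d → c ≠ d → w ∈ far G z →
      G.Adj w a → G.Adj w b → False := by
    intro a b c d w hab hac had hbc hbd hcd hw hwa hwb
    obtain ⟨hwz, hzw⟩ := mem_far.1 hw
    refine h.free.false_of_fan (z := a) (a := w) (b := b) (c := c) (d := z) (e := d) hwa.symm
      hab.1 hac.1 hab.2.1.symm had.1 hwb hbc.1 hac.2.2.symm had.2.2 ?_ hwz ?_ hab.2.2.ne'
      hbd.ne hcd <;> rintro rfl
    · exact hzw hac.2.2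
    · exact hzw had.2.2
  have side : ∀ {a b c d w : V}, (linkGraph G z).Adj a b → (linkGraph G z).Adj a c →
      (linkGraph G z).Adj a d → (linkGraph G z).Adj b c →
      (linkGraph G z).Adj b d → c ≠ d → w ∈ far G z →
      G.Adj w a → G.Adj w c → False := by
    intro a b c d w hab hac had hbc hbd hcd hw hwa hwb
    obtain ⟨hwz, hzw⟩ := mem_far.1 hw
    refine h.free.false_of_fan (z := a) (a := w) (b := c) (c := b) (d := d) (e := z) hwa.symm
      hac.1 hab.1 had.1 hab.2.1.symm hwb hbc.1.symm hbd.1 had.2.2.symm ?_ ?_ hwz hcd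
      hac.2.2.ne' hab.2.2.ne' <;> rintro rfl
    · exact hzw hab.2.2
    · exact hzw had.2.2
  have xa := h.le_one a
  have xb := h.le_one b
  have xc := h.le_one c
  have xd := h.le_one d
  have ya := h.nonneg a
  have yb := h.nonneg b
  have yc := h.nonneg c
  have yd := h.nonneg d
  have hr := h.large
  unfold Piece missing
  simp only [sum_four hab.ne hac.ne had.ne hbc.ne hbd.ne hcd, ea, eb, ec, ed]
  refine Or.inr (Or.inr (Or.inl ⟨Finset.card_le_four, fun w hw => ?_, fun hlt => ?_⟩))
  · have nab := mid hab hac had hbc hbd hcd hw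
    have nac := side hab hac had hbc hbd hcd hw
    have nad := side hab had hac hbd hbc hcd.symm hw
    have nbc := side hab.symm hbc hbd hac had hcd hw
    have nbd := side hab.symm hbd hbc had hac hcd.symm hw
    unfold ind
    split_ifs <;> first | linarith | (exfalso; tauto)
  · have hs : 1 ≤ x a + x b := by linarith
    have ht : 4 ≤ r * (x c + x d) := by nlinarith
    nlinarith

/-- Two vertices at distance two from `z` attached to different edges `ab`, `ad` of the link of `z`
create a fan with hub `a`. -/
theorem false_of_two_spokes (h : PerronData G z x r) {a b d v w : V}
    (hab : (linkGraph G z).Adj a b) (had : (linkGraph G z).Adj a d) (hbd : b ≠ d)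
    (hv : v ∈ far G z) (hw : w ∈ far G z) (hvw : v ≠ w) (hva : G.Adj v a) (hvb : G.Adj v b)
    (hwa : G.Adj w a) (hwd : G.Adj w d) : False := by
  obtain ⟨hwz, hzw⟩ := mem_far.1 hw
  obtain ⟨hvz, hzv⟩ := mem_far.1 hv
  refine h.free.false_of_fan (z := a) (a := v) (b := b) (c := z) (d := d) (e := w) hva.symm
    hab.1 hab.2.1.symm had.1 hwa.symm hvb hab.2.2.symm had.2.2 hwd.symm hvz ?_ hvw hbd ?_
    hwz.symm <;> rintro rfl
  · exact hzv had.2.2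
  · exact hzw hab.2.2

theorem piece_C4 (h : PerronData G z x r) {a b c d : V}
    (hab : (linkGraph G z).Adj a b) (hbc : (linkGraph G z).Adj b c)
    (hcd : (linkGraph G z).Adj c d) (hda : (linkGraph G z).Adj d a) (hac : a ≠ c) (hbd : b ≠ d)
    (hNa : (linkGraph G z).neighborFinset a = {b, d})
    (hNb : (linkGraph G z).neighborFinset b = {a, c})
    (hNc : (linkGraph G z).neighborFinset c = {b, d})
    (hNd : (linkGraph G z).neighborFinset d = {a, c}) :
    Piece G z x r {a, b, c, d} := by
  obtain ⟨ea, ra, -⟩ := h.degree_two hab.2.1 hNa hbd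
  obtain ⟨eb, rb, -⟩ := h.degree_two hab.2.2 hNb hac
  obtain ⟨ec, rc, -⟩ := h.degree_two hcd.2.1 hNc hbd
  obtain ⟨ed, rd, -⟩ := h.degree_two hcd.2.2 hNd hac
  have xa := h.le_one a
  have xb := h.le_one b
  have xc := h.le_one c
  have xd := h.le_one d
  have ya := h.nonneg a
  have yb := h.nonneg b
  have yc := h.nonneg c
  have yd := h.nonneg d
  have hr := h.large
  have hS : ({a, b, c, d} : Finset V) ⊆ G.neighborFinset z := by
    intro v hv
    simp only [Finset.mem_insert, Finset.mem_singleton] at hv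
    rw [SimpleGraph.mem_neighborFinset]
    rcases hv with rfl | rfl | rfl | rfl
    exacts [hab.2.1, hab.2.2, hcd.2.1, hcd.2.2]
  obtain ⟨E, hE1, hE⟩ : ∃ E : Finset V, E.card ≤ 1 ∧ ∀ w ∈ far G z, w ∉ E →
      x a + x b + x c + x d - 2 ≤ missing G x {a, b, c, d} w := by
    have spec : ∀ w, missing G x {a, b, c, d} w < x a + x b + x c + x d - 2 →
        (G.Adj w d ∧ G.Adj w a ∧ G.Adj w b) ∨ (G.Adj w a ∧ G.Adj w b ∧ G.Adj w c) ∨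
        (G.Adj w b ∧ G.Adj w c ∧ G.Adj w d) ∨ (G.Adj w c ∧ G.Adj w d ∧ G.Adj w a) := by
      intro w hw
      by_contra hcon
      unfold missing ind at hw
      rw [sum_four hab.ne hac hda.ne' hbc.ne hbd hcd.ne] at hw
      split_ifs at hw <;> first | linarith | (apply hcon; tauto)
    by_cases hex : ∃ w ∈ far G z, missing G x {a, b, c, d} w < x a + x b + x c + x d - 2
    · obtain ⟨w, hw, hwm⟩ := hex
      refine ⟨{w}, by simp, fun v hv hvw => ?_⟩
      rw [Finset.mem_singleton] at hvw
      by_contra! hvm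
      have fa := h.false_of_two_spokes hab hda.symm hbd hv hw hvw
      have fb := h.false_of_two_spokes hbc hab.symm hac.symm hv hw hvw
      have fc := h.false_of_two_spokes hcd hbc.symm hbd.symm hv hw hvw
      have fd := h.false_of_two_spokes hda hcd.symm hac hv hw hvw
      have fa' := h.false_of_two_spokes hda.symm hab hbd.symm hv hw hvw
      have fb' := h.false_of_two_spokes hab.symm hbc hac hv hw hvw
      have fc' := h.false_of_two_spokes hbc.symm hcd hbd hv hw hvw
      rcases spec w hwm with ⟨_, _, _⟩ | ⟨_, _, _⟩ | ⟨_, _, _⟩ | ⟨_, _, _⟩ <;>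
        rcases spec v hvm with ⟨_, _, _⟩ | ⟨_, _, _⟩ | ⟨_, _, _⟩ | ⟨_, _, _⟩ <;>
          first
            | (apply fa <;> assumption) | (apply fb <;> assumption)
            | (apply fc <;> assumption) | (apply fd <;> assumption)
            | (apply fa' <;> assumption) | (apply fb' <;> assumption)
            | (apply fc' <;> assumption)
    · push Not at hex
      exact ⟨∅, by simp, fun w hw _ => hex w hw⟩
  have hE2 : (E.card : ℝ) ≤ 1 := by exact_mod_cast hE1
  unfold Piece
  simp only [sum_four hab.ne hac hda.ne' hbc.ne hbd hcd.ne, ea, eb, ec, ed]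
  refine Or.inr (Or.inr (Or.inr ⟨by linarith, fun hout => ?_⟩))
  have ca := h.cost_nonneg a
  have cb := h.cost_nonneg b
  have cc := h.cost_nonneg c
  have cd := h.cost_nonneg d
  rcases le_or_gt (x a + x b + x c + x d) 3 with hle | hlt
  · linarith
  · have hq : 0 ≤ x a + x b + x c + x d - 2 := by linarith
    have la := h.cost_lower hS hout E hq a fun w hw hwE _ => hE w hw hwE
    have lb := h.cost_lower hS hout E hq b fun w hw hwE _ => hE w hw hwE
    have lc := h.cost_lower hS hout E hq c fun w hw hwE _ => hE w hw hwE
    have ld := h.cost_lower hS hout E hq d fun w hw hwE _ => hE w hw hwE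
    have hn : r ≤ outDeg G z a + outDeg G z b + outDeg G z c + outDeg G z d - 4 * E.card := by
      have := mul_pos (show 0 < r - 2 by linarith) (sub_pos.2 hlt)
      linarith
    have hqn := mul_le_mul_of_nonneg_left hn hq
    have hfin : r * (x a + x b + x c + x d - 2) ≤
        r * (cost G z x a + cost G z x b + cost G z x c + cost G z x d) := by
      linarith
    linarith [le_of_mul_le_mul_left hfin (by linarith)]

theorem piece_K3 (h : PerronData G z x r) {a b c : V}
    (hab : (linkGraph G z).Adj a b) (hbc : (linkGraph G z).Adj b c)
    (hca : (linkGraph G z).Adj c a)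
    (hNa : (linkGraph G z).neighborFinset a = {b, c})
    (hNb : (linkGraph G z).neighborFinset b = {a, c})
    (hNc : (linkGraph G z).neighborFinset c = {a, b}) :
    Piece G z x r {a, b, c} := by
  obtain ⟨ea, ra, -⟩ := h.degree_two hab.2.1 hNa hbc.ne
  obtain ⟨eb, rb, -⟩ := h.degree_two hab.2.2 hNb hca.ne'
  obtain ⟨ec, rc, -⟩ := h.degree_two hca.2.1 hNc hab.ne
  have xa := h.le_one a
  have xb := h.le_one b
  have xc := h.le_one c
  have ya := h.nonneg a
  have yb := h.nonneg b
  have yc := h.nonneg c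
  have hr := h.large
  have hS : ({a, b, c} : Finset V) ⊆ G.neighborFinset z := by
    intro v hv
    simp only [Finset.mem_insert, Finset.mem_singleton] at hv
    rw [SimpleGraph.mem_neighborFinset]
    rcases hv with rfl | rfl | rfl
    exacts [hab.2.1, hab.2.2, hca.2.1]
  unfold Piece
  simp only [sum_three hab.ne hca.ne' hbc.ne, ea, eb, ec]
  refine Or.inr (Or.inr (Or.inr ⟨by linarith, fun hout => ?_⟩))
  have ca := h.cost_nonneg a
  have cb := h.cost_nonneg b
  have cc := h.cost_nonneg c
  rcases le_or_gt (x a + x b + x c) 2 with hle | hlt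
  · linarith
  have hprod := mul_pos (show 0 < r - 2 by linarith) (sub_pos.2 hlt)
  have hn : (r - 2) * (x a + x b + x c) - 3 ≤ outDeg G z a + outDeg G z b + outDeg G z c := by
    linarith
  by_cases hex : ∃ w ∈ far G z, G.Adj w a ∧ G.Adj w b ∧ G.Adj w c
  · obtain ⟨w, hw, wa, wb, wc⟩ := hex
    have hq : 0 ≤ x a + x b + x c - 1 := by linarith
    have hE : ∀ v ∈ far G z, v ∉ ({w} : Finset V) →
        x a + x b + x c - 1 ≤ missing G x {a, b, c} v := by
      intro v hv hvw
      rw [Finset.mem_singleton] at hvw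
      have nab := fun va vb => h.false_of_two_spokes hab hca.symm hbc.ne hv hw hvw va vb wa wc
      have nbc := fun vb vc => h.false_of_two_spokes hbc hab.symm hca.ne hv hw hvw vb vc wb wa
      have nca := fun vc va => h.false_of_two_spokes hca hbc.symm hab.ne hv hw hvw vc va wc wb
      rw [missing, sum_three hab.ne hca.ne' hbc.ne]
      unfold ind
      split_ifs <;> first | linarith | (exfalso; tauto)
    have la := h.cost_lower hS hout {w} hq a fun w hw hwE _ => hE w hw hwE
    have lb := h.cost_lower hS hout {w} hq b fun w hw hwE _ => hE w hw hwE
    have lc := h.cost_lower hS hout {w} hq c fun w hw hwE _ => hE w hw hwE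
    rw [Finset.card_singleton, Nat.cast_one] at la lb lc
    have hn' : 2 * r - 10 ≤ outDeg G z a + outDeg G z b + outDeg G z c - 3 := by linarith
    have hqn := mul_le_mul_of_nonneg_left hn' hq
    have hfin : r * (x a + x b + x c - 2) ≤
        r * (cost G z x a + cost G z x b + cost G z x c) := by
      nlinarith
    linarith [le_of_mul_le_mul_left hfin (by linarith)]
  · have hq : 0 ≤ x a + x b + x c - 2 := by linarith
    have hE : ∀ v ∈ far G z, v ∉ (∅ : Finset V) →
        x a + x b + x c - 2 ≤ missing G x {a, b, c} v := by
      intro v hv _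
      have hnot : ¬ (G.Adj v a ∧ G.Adj v b ∧ G.Adj v c) := fun hcon => hex ⟨v, hv, hcon⟩
      rw [missing, sum_three hab.ne hca.ne' hbc.ne]
      unfold ind
      split_ifs <;> first | linarith | (exfalso; tauto)
    have la := h.cost_lower hS hout ∅ hq a fun w hw hwE _ => hE w hw hwE
    have lb := h.cost_lower hS hout ∅ hq b fun w hw hwE _ => hE w hw hwE
    have lc := h.cost_lower hS hout ∅ hq c fun w hw hwE _ => hE w hw hwE
    rw [Finset.card_empty, Nat.cast_zero] at la lb lc
    have hn' : r ≤ outDeg G z a + outDeg G z b + outDeg G z c := by linarith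
    have hqn := mul_le_mul_of_nonneg_left hn' hq
    have hfin : r * (x a + x b + x c - 2) ≤
        r * (cost G z x a + cost G z x b + cost G z x c) := by
      linarith
    linarith [le_of_mul_le_mul_left hfin (by linarith)]

theorem piece_star_plus_edge (h : PerronData G z x r) {a b c : V} {L : Finset V}
    (hab : (linkGraph G z).Adj a b) (hbc : (linkGraph G z).Adj b c)
    (hca : (linkGraph G z).Adj c a) (hL : L.Nonempty) (haL : a ∉ L) (hbL : b ∉ L) (hcL : c ∉ L)
    (hNa : (linkGraph G z).neighborFinset a = insert b (insert c L))
    (hNb : (linkGraph G z).neighborFinset b = {a, c})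
    (hNc : (linkGraph G z).neighborFinset c = {a, b})
    (hNl : ∀ l ∈ L, (linkGraph G z).neighborFinset l = {a}) :
    Piece G z x r (insert a (insert b (insert c L))) := by
  obtain ⟨eb, rb, -⟩ := h.degree_two hab.2.2 hNb hca.ne'
  obtain ⟨ec, rc, -⟩ := h.degree_two hca.2.1 hNc hab.ne
  have xa := h.le_one a
  have xb := h.le_one b
  have xc := h.le_one c
  have ya := h.nonneg a
  have yb := h.nonneg b
  have yc := h.nonneg c
  have hr := h.large
  have hbcL : b ∉ insert c L := by simp [hbc.ne, hbL]
  have habcL : a ∉ insert b (insert c L) := by simp [hab.ne, hca.ne', haL]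
  have hda : (linkGraph G z).degree a = L.card + 2 := by
    rw [← SimpleGraph.card_neighborFinset_eq_degree, hNa, Finset.card_insert_of_notMem hbcL,
      Finset.card_insert_of_notMem hcL]
  have hsum : ∀ f : V → ℝ, ∑ u ∈ insert a (insert b (insert c L)), f u =
      f a + f b + f c + ∑ l ∈ L, f l := by
    intro f
    rw [Finset.sum_insert habcL, Finset.sum_insert hbcL, Finset.sum_insert hcL]
    ring
  have hleaf : ∑ l ∈ L, excess G z x l = -(L.card : ℝ) / 2 := by
    rw [Finset.sum_congr rfl fun l hl => show excess G z x l = -1 / 2 by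
      rw [excess, ← SimpleGraph.card_neighborFinset_eq_degree, hNl l hl]; norm_num]
    rw [Finset.sum_const, nsmul_eq_mul]
    ring
  have hk : (1 : ℝ) ≤ L.card := by exact_mod_cast hL.card_pos
  have hγ : ∑ u ∈ insert a (insert b (insert c L)), excess G z x u ≤
      2 * x a + x b + x c - 4 := by
    rw [hsum, hleaf, eb, ec, excess, hda]
    push_cast
    nlinarith
  refine Or.inr (Or.inr (Or.inr ⟨by linarith, fun hout => ?_⟩))
  obtain ⟨l, hl⟩ := hL
  have hal : (linkGraph G z).Adj a l := by
    rw [← SimpleGraph.mem_neighborFinset, hNa]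
    simp [hl]
  have hlb : l ≠ b := fun e => hbL (e ▸ hl)
  have hlc : l ≠ c := fun e => hcL (e ▸ hl)
  have fan : ∀ {b c w : V}, (linkGraph G z).Adj a b → (linkGraph G z).Adj b c →
      (linkGraph G z).Adj c a → l ≠ b → l ≠ c → w ∈ far G z → G.Adj w b → G.Adj w a → False := by
    intro b c w hab hbc hca hlb hlc hw hwb hwa
    obtain ⟨hwz, hzw⟩ := mem_far.1 hw
    refine h.free.false_of_fan (z := a) (a := w) (b := b) (c := c) (d := z) (e := l) hwa.symm
      hab.1 hca.1.symm hab.2.1.symm hal.1 hwb hbc.1 hca.2.1.symm hal.2.2 ?_ hwz ?_ hab.2.2.ne'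
      hlb.symm hlc.symm <;> rintro rfl
    · exact hzw hca.2.1
    · exact hzw hal.2.2
  have hmiss : ∀ w, ¬ G.Adj w a → x a ≤ missing G x {a} w := by
    intro w hw
    rw [missing, Finset.sum_singleton, ind_of_not_adj hw]
    linarith
  have hS : ({a} : Finset V) ⊆ G.neighborFinset z := by
    rw [Finset.singleton_subset_iff, SimpleGraph.mem_neighborFinset]
    exact hab.2.1
  have lb := h.cost_lower hS hout ∅ ya b fun w hw _ hbw =>
    hmiss w (fan hab hbc hca hlb hlc hw hbw.symm)
  have lc := h.cost_lower hS hout ∅ ya c fun w hw _ hcw =>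
    hmiss w (fan hca.symm hbc.symm hab.symm hlc hlb hw hcw.symm)
  rw [Finset.card_empty, Nat.cast_zero] at lb lc
  have hcost : cost G z x b + cost G z x c ≤
      ∑ u ∈ insert a (insert b (insert c L)), cost G z x u := by
    rw [hsum]
    linarith [h.cost_nonneg a, Finset.sum_nonneg fun l (_ : l ∈ L) => h.cost_nonneg l]
  have hn : (r - 1) * (x b + x c) - 2 - 2 * x a ≤ outDeg G z b + outDeg G z c := by linarith
  have hqn := mul_le_mul_of_nonneg_left hn ya
  have h1 : 0 ≤ r * ((2 - x b - x c) * (1 - x a)) :=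
    mul_nonneg (by linarith) (mul_nonneg (by linarith) (by linarith))
  have h2 : x a * (x b + x c) ≤ 2 := by nlinarith
  have h3 : x a * x a ≤ 1 := by nlinarith
  have hfin : r * (2 * x a + x b + x c - 3) ≤ r * (cost G z x b + cost G z x c) := by
    linarith
  linarith [le_of_mul_le_mul_left hfin (by linarith)]

theorem piece_tree (h : PerronData G z x r) {S : Finset V}
    (hdeg : ∀ u ∈ S, 1 ≤ (linkGraph G z).degree u)
    (hS : ∑ u ∈ S, (linkGraph G z).degree u + 2 = 2 * S.card) : Piece G z x r S := by
  left
  have h1 : ∑ u ∈ S, excess G z x u ≤ ∑ u ∈ S, (((linkGraph G z).degree u : ℝ) / 2 - 1) := by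
    refine Finset.sum_le_sum fun u hu => ?_
    have h2 : (1 : ℝ) ≤ (linkGraph G z).degree u := by exact_mod_cast hdeg u hu
    have h3 := h.le_one u
    rw [excess]
    nlinarith
  rw [Finset.sum_sub_distrib, ← Finset.sum_div, Finset.sum_const, nsmul_eq_mul, mul_one] at h1
  have h4 : (∑ u ∈ S, ((linkGraph G z).degree u : ℝ)) + 2 = 2 * S.card := by exact_mod_cast hS
  linarith

theorem piece_of_four_cycle (h : PerronData G z x r) {C : (linkGraph G z).ConnectedComponent}
    {a b c d : V} (ha : a ∈ C.supp) (hab : (linkGraph G z).Adj a b)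
    (hbc : (linkGraph G z).Adj b c) (hcd : (linkGraph G z).Adj c d)
    (hda : (linkGraph G z).Adj d a) (hac : a ≠ c) (hbd : b ≠ d) :
    Piece G z x r C.supp.toFinset := by
  have hsupp := (h.free.pathFiveFree_linkGraph z).supp_eq_of_four_cycle ha hab hbc hcd hda hac hbd
  have hS : C.supp.toFinset = {a, b, c, d} := by
    ext v; simp [hsupp]
  have hb := mem_supp_of_adj hab ha
  have hc := mem_supp_of_adj hbc hb
  have hd := mem_supp_of_adj hcd hc
  have hcl : ∀ u ∈ C.supp, ∀ v, (linkGraph G z).Adj u v → v = a ∨ v = b ∨ v = c ∨ v = d := by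
    intro u hu v huv
    have hv := mem_supp_of_adj huv hu
    rw [hsupp] at hv
    simpa using hv
  have nbr : ∀ u ∈ C.supp, ∀ T : Finset V, (∀ v ∈ T, (linkGraph G z).Adj u v) →
      (∀ v, v = a ∨ v = b ∨ v = c ∨ v = d → (linkGraph G z).Adj u v → v ∈ T) →
      (linkGraph G z).neighborFinset u = T := by
    intro u hu T h1 h2
    ext v
    rw [SimpleGraph.mem_neighborFinset]
    exact ⟨fun huv => h2 v (hcl u hu v huv) huv, h1 v⟩
  have ia := (linkGraph G z).irrefl (v := a)
  have ib := (linkGraph G z).irrefl (v := b)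
  have ic := (linkGraph G z).irrefl (v := c)
  have id' := (linkGraph G z).irrefl (v := d)
  rw [hS]
  by_cases h1 : (linkGraph G z).Adj a c <;> by_cases h2 : (linkGraph G z).Adj b d
  · refine h.piece_K4 hab h1 hda.symm hbc h2 hcd (nbr a ha _ ?_ ?_) (nbr b hb _ ?_ ?_)
      (nbr c hc _ ?_ ?_) (nbr d hd _ ?_ ?_)
    all_goals simp [*, SimpleGraph.Adj.symm]
  · have e : ({a, b, c, d} : Finset V) = {a, c, b, d} := by ext; simp; tauto
    rw [e]
    have h2' := fun h' => h2 (SimpleGraph.Adj.symm h')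
    refine h.piece_K4_minus_edge h1 hab hda.symm hbc.symm hcd hbd (nbr a ha _ ?_ ?_)
      (nbr c hc _ ?_ ?_) (nbr b hb _ ?_ ?_) (nbr d hd _ ?_ ?_)
    all_goals simp [*, SimpleGraph.Adj.symm] <;> tauto
  · have e : ({a, b, c, d} : Finset V) = {b, d, a, c} := by ext; simp; tauto
    rw [e]
    have h1' := fun h' => h1 (SimpleGraph.Adj.symm h')
    refine h.piece_K4_minus_edge h2 hab.symm hbc hda hcd.symm hac (nbr b hb _ ?_ ?_)
      (nbr d hd _ ?_ ?_) (nbr a ha _ ?_ ?_) (nbr c hc _ ?_ ?_)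
    all_goals simp [*, SimpleGraph.Adj.symm] <;> tauto
  · have h1' := fun h' => h1 (SimpleGraph.Adj.symm h')
    have h2' := fun h' => h2 (SimpleGraph.Adj.symm h')
    refine h.piece_C4 hab hbc hcd hda hac hbd (nbr a ha _ ?_ ?_)
      (nbr b hb _ ?_ ?_) (nbr c hc _ ?_ ?_) (nbr d hd _ ?_ ?_)
    all_goals simp [*, SimpleGraph.Adj.symm] <;> tauto

theorem piece_of_pendant_triangle (h : PerronData G z x r)
    {C : (linkGraph G z).ConnectedComponent} {a b c l : V} (ha : a ∈ C.supp)
    (hab : (linkGraph G z).Adj a b) (hbc : (linkGraph G z).Adj b c)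
    (hca : (linkGraph G z).Adj c a) (hal : (linkGraph G z).Adj a l) (hlb : l ≠ b) (hlc : l ≠ c)
    (h4 : ∀ a b c d, a ∈ C.supp → (linkGraph G z).Adj a b → (linkGraph G z).Adj b c →
      (linkGraph G z).Adj c d → (linkGraph G z).Adj d a → a ≠ c → b ≠ d → False) :
    Piece G z x r C.supp.toFinset := by
  obtain ⟨h1, h2, h3, h5⟩ :=
    (h.free.pathFiveFree_linkGraph z).star_of_pendant_triangle ha hab hbc hca hal hlb hlc h4
  set L : Finset V := (((linkGraph G z).neighborFinset a).erase b).erase c with hL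
  have hmem : ∀ v, v ∈ L ↔ v ≠ c ∧ v ≠ b ∧ (linkGraph G z).Adj a v := by
    intro v
    rw [hL, Finset.mem_erase, Finset.mem_erase, SimpleGraph.mem_neighborFinset]
  have hS : C.supp.toFinset = insert a (insert b (insert c L)) := by
    ext v
    rw [Set.mem_toFinset, h1, Finset.mem_insert, Finset.mem_insert, Finset.mem_insert, hmem]
    constructor
    · tauto
    · rintro (rfl | rfl | rfl | hv)
      · exact Or.inl rfl
      · exact Or.inr hab
      · exact Or.inr hca.symm
      · exact Or.inr hv.2.2
  rw [hS]
  refine h.piece_star_plus_edge hab hbc hca ⟨l, (hmem l).2 ⟨hlc, hlb, hal⟩⟩ ?_ ?_ ?_ ?_ ?_ ?_ ?_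
  · rw [hmem]
    exact fun hv => (linkGraph G z).irrefl hv.2.2
  · rw [hmem]
    exact fun hv => hv.2.1 rfl
  · rw [hmem]
    exact fun hv => hv.1 rfl
  · ext v
    rw [SimpleGraph.mem_neighborFinset, Finset.mem_insert, Finset.mem_insert, hmem]
    constructor
    · tauto
    · rintro (rfl | rfl | hv)
      · exact hab
      · exact hca.symm
      · exact hv.2.2
  · ext v
    rw [SimpleGraph.mem_neighborFinset, Finset.mem_insert, Finset.mem_singleton]
    refine ⟨h3 v, ?_⟩
    rintro (rfl | rfl)
    · exact hab.symm
    · exact hbc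
  · ext v
    rw [SimpleGraph.mem_neighborFinset, Finset.mem_insert, Finset.mem_singleton]
    refine ⟨h5 v, ?_⟩
    rintro (rfl | rfl)
    · exact hca
    · exact hbc.symm
  · intro v hv
    obtain ⟨hvc, hvb, hav⟩ := (hmem v).1 hv
    ext y
    rw [SimpleGraph.mem_neighborFinset, Finset.mem_singleton]
    refine ⟨h2 v hav hvb hvc y, ?_⟩
    rintro rfl
    exact hav.symm

theorem piece_of_triangle (h : PerronData G z x r) {C : (linkGraph G z).ConnectedComponent}
    {a b c : V} (ha : a ∈ C.supp) (hab : (linkGraph G z).Adj a b)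
    (hbc : (linkGraph G z).Adj b c) (hca : (linkGraph G z).Adj c a)
    (h4 : ∀ a b c d, a ∈ C.supp → (linkGraph G z).Adj a b → (linkGraph G z).Adj b c →
      (linkGraph G z).Adj c d → (linkGraph G z).Adj d a → a ≠ c → b ≠ d → False) :
    Piece G z x r C.supp.toFinset := by
  have hb := mem_supp_of_adj hab ha
  have hc := mem_supp_of_adj hbc hb
  by_cases h1 : ∃ l, (linkGraph G z).Adj a l ∧ l ≠ b ∧ l ≠ c
  · obtain ⟨l, hl, hlb, hlc⟩ := h1
    exact h.piece_of_pendant_triangle ha hab hbc hca hl hlb hlc h4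
  by_cases h2 : ∃ l, (linkGraph G z).Adj b l ∧ l ≠ c ∧ l ≠ a
  · obtain ⟨l, hl, hlb, hlc⟩ := h2
    exact h.piece_of_pendant_triangle hb hbc hca hab hl hlb hlc h4
  by_cases h3 : ∃ l, (linkGraph G z).Adj c l ∧ l ≠ a ∧ l ≠ b
  · obtain ⟨l, hl, hlb, hlc⟩ := h3
    exact h.piece_of_pendant_triangle hc hca hab hbc hl hlb hlc h4
  have ka : ∀ v, (linkGraph G z).Adj a v → v = b ∨ v = c := fun v hv => by
    by_contra! hne
    exact h1 ⟨v, hv, hne.1, hne.2⟩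
  have kb : ∀ v, (linkGraph G z).Adj b v → v = a ∨ v = c := fun v hv => by
    by_contra! hne
    exact h2 ⟨v, hv, hne.2, hne.1⟩
  have kc : ∀ v, (linkGraph G z).Adj c v → v = a ∨ v = b := fun v hv => by
    by_contra! hne
    exact h3 ⟨v, hv, hne.1, hne.2⟩
  have hsupp : C.supp = {a, b, c} := by
    refine supp_eq_of_isolated_triangle ha hab hca fun u hu v huv => ?_
    simp only [Set.mem_insert_iff, Set.mem_singleton_iff] at hu ⊢
    rcases hu with rfl | rfl | rfl
    · exact Or.inr (ka v huv)
    · exact (kb v huv).imp id Or.inr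
    · exact (kc v huv).imp id Or.inl
  have hS : C.supp.toFinset = {a, b, c} := by
    ext v; simp [hsupp]
  rw [hS]
  refine h.piece_K3 hab hbc hca ?_ ?_ ?_
  · ext v
    rw [SimpleGraph.mem_neighborFinset, Finset.mem_insert, Finset.mem_singleton]
    refine ⟨ka v, ?_⟩
    rintro (rfl | rfl)
    · exact hab
    · exact hca.symm
  · ext v
    rw [SimpleGraph.mem_neighborFinset, Finset.mem_insert, Finset.mem_singleton]
    refine ⟨kb v, ?_⟩
    rintro (rfl | rfl)
    · exact hab.symm
    · exact hbc
  · ext v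
    rw [SimpleGraph.mem_neighborFinset, Finset.mem_insert, Finset.mem_singleton]
    refine ⟨kc v, ?_⟩
    rintro (rfl | rfl)
    · exact hca
    · exact hbc.symm

theorem piece_supp (h : PerronData G z x r) (C : (linkGraph G z).ConnectedComponent) :
    Piece G z x r C.supp.toFinset := by
  by_cases h1 : ∃ v ∈ C.supp, ∀ u, ¬ (linkGraph G z).Adj v u
  · obtain ⟨v, hv, hiso⟩ := h1
    have hsub : C.supp ⊆ {v} := supp_subset_of_closed C (a := v)
      (fun u hu y huy => absurd huy (by rw [Set.mem_singleton_iff.1 hu]; exact hiso y))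
      rfl hv
    have hS : C.supp.toFinset = {v} := by
      ext u
      rw [Set.mem_toFinset, Finset.mem_singleton]
      exact ⟨fun hu => hsub hu, fun hu => hu ▸ hv⟩
    have hd : (linkGraph G z).degree v = 0 := by
      rw [SimpleGraph.degree, Finset.card_eq_zero, Finset.eq_empty_iff_forall_notMem]
      exact fun u hu => hiso u ((SimpleGraph.mem_neighborFinset _ _ _).1 hu)
    refine Or.inr (Or.inl ⟨v, hS, ?_⟩)
    rw [hS, Finset.sum_singleton, excess, hd]
    norm_num
  by_cases h4 : ∃ a b c d, a ∈ C.supp ∧ (linkGraph G z).Adj a b ∧ (linkGraph G z).Adj b c ∧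
      (linkGraph G z).Adj c d ∧ (linkGraph G z).Adj d a ∧ a ≠ c ∧ b ≠ d
  · obtain ⟨a, b, c, d, ha, hab, hbc, hcd, hda, hac, hbd⟩ := h4
    exact h.piece_of_four_cycle ha hab hbc hcd hda hac hbd
  have h4' : ∀ a b c d, a ∈ C.supp → (linkGraph G z).Adj a b → (linkGraph G z).Adj b c →
      (linkGraph G z).Adj c d → (linkGraph G z).Adj d a → a ≠ c → b ≠ d → False :=
    fun a b c d ha hab hbc hcd hda hac hbd => h4 ⟨a, b, c, d, ha, hab, hbc, hcd, hda, hac, hbd⟩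
  by_cases h3 : ∃ a b c, a ∈ C.supp ∧ (linkGraph G z).Adj a b ∧ (linkGraph G z).Adj b c ∧
      (linkGraph G z).Adj c a
  · obtain ⟨a, b, c, ha, hab, hbc, hca⟩ := h3
    exact h.piece_of_triangle ha hab hbc hca h4'
  refine h.piece_tree (fun u hu => ?_)
    ((h.free.pathFiveFree_linkGraph z).sum_degree_add_two C
      (fun a b c ha hab hbc hca => h3 ⟨a, b, c, ha, hab, hbc, hca⟩) h4')
  by_contra hd
  refine h1 ⟨u, Set.mem_toFinset.1 hu, fun v huv => hd ?_⟩
  exact ((linkGraph G z).degree_pos_iff_exists_adj u).2 ⟨v, huv⟩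

theorem degree_linkGraph {u : V} (hu : G.Adj z u) :
    ((linkGraph G z).degree u : ℝ) = ∑ v ∈ G.neighborFinset z, ind G u v := by
  have h := sum_link_neighborFinset hu fun _ => (1 : ℝ)
  simpa using h

theorem degree_eq_sum_ind (v : V) : (G.degree v : ℝ) = ∑ u, ind G v u := by
  unfold ind
  rw [Finset.sum_boole, SimpleGraph.degree, SimpleGraph.neighborFinset_eq_filter]

/-- Counting edges by the distance of their endpoints to `z`. -/
theorem two_mul_card_edgeFinset (G : SimpleGraph V) (z : V) :
    2 * (G.edgeFinset.card : ℝ) = 2 * (G.neighborFinset z).card +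
      ∑ u ∈ G.neighborFinset z, ((linkGraph G z).degree u : ℝ) +
      2 * ∑ u ∈ G.neighborFinset z, outDeg G z u + ∑ w ∈ far G z, outDeg G z w := by
  have h1 : ∑ v, (G.degree v : ℝ) = 2 * (G.edgeFinset.card : ℝ) := by
    exact_mod_cast G.sum_degrees_eq_twice_card_edges
  have h2 : ∀ u ∈ G.neighborFinset z,
      (G.degree u : ℝ) = 1 + (linkGraph G z).degree u + outDeg G z u := fun u hu => by
    rw [SimpleGraph.mem_neighborFinset] at hu
    rw [degree_eq_sum_ind, sum_split (G := G) (z := z), ind_of_adj hu.symm, degree_linkGraph hu,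
      outDeg]
  have h3 : ∀ w ∈ far G z,
      (G.degree w : ℝ) = ∑ u ∈ G.neighborFinset z, ind G w u + outDeg G z w := fun w hw => by
    rw [degree_eq_sum_ind, sum_split (G := G) (z := z),
      ind_of_not_adj fun hz => (mem_far.1 hw).2 hz.symm, zero_add, outDeg]
  have h4 : ∑ w ∈ far G z, ∑ u ∈ G.neighborFinset z, ind G w u =
      ∑ u ∈ G.neighborFinset z, outDeg G z u := by
    rw [Finset.sum_comm]
    exact Finset.sum_congr rfl fun u _ => Finset.sum_congr rfl fun w _ => ind_comm w u
  rw [← h1, sum_split (G := G) (z := z), Finset.sum_congr rfl h2, Finset.sum_congr rfl h3,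
    Finset.sum_add_distrib, Finset.sum_add_distrib, Finset.sum_add_distrib, h4,
    ← SimpleGraph.card_neighborFinset_eq_degree, Finset.sum_const, nsmul_eq_mul]
  ring

/-- The quadratic expression in the eigenvalue, in terms of the local quantities at `z`. -/
theorem sq_sub_self_eq (h : PerronData G z x r) :
    r ^ 2 - r = G.edgeFinset.card + ∑ u ∈ G.neighborFinset z, excess G z x u -
      ∑ u ∈ G.neighborFinset z, cost G z x u - (∑ w ∈ far G z, outDeg G z w) / 2 := by
  have h1 : r ^ 2 = ∑ u ∈ G.neighborFinset z, r * x u := by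
    rw [← Finset.mul_sum, ← h.r_eq, sq]
  have h2 : ∑ u ∈ G.neighborFinset z, ∑ v ∈ (linkGraph G z).neighborFinset u, x v =
      ∑ u ∈ G.neighborFinset z, ((linkGraph G z).degree u : ℝ) * x u := by
    rw [Finset.sum_congr rfl fun u hu =>
      sum_link_neighborFinset ((SimpleGraph.mem_neighborFinset _ _ _).1 hu) x, Finset.sum_comm]
    refine Finset.sum_congr rfl fun v hv => ?_
    rw [degree_linkGraph ((SimpleGraph.mem_neighborFinset _ _ _).1 hv), Finset.sum_mul]
    exact Finset.sum_congr rfl fun u _ => by rw [ind_comm]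
  have h3 : ∑ u ∈ G.neighborFinset z, excess G z x u =
      ∑ u ∈ G.neighborFinset z, ((linkGraph G z).degree u : ℝ) * x u - r -
        (∑ u ∈ G.neighborFinset z, ((linkGraph G z).degree u : ℝ)) / 2 := by
    rw [h.r_eq, Finset.sum_div, ← Finset.sum_sub_distrib, ← Finset.sum_sub_distrib]
    exact Finset.sum_congr rfl fun u _ => by rw [excess]; ring
  have h4 := two_mul_card_edgeFinset G z
  rw [Finset.sum_congr rfl fun u hu =>
    h.eig_neighbor ((SimpleGraph.mem_neighborFinset _ _ _).1 hu), Finset.sum_sub_distrib,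
    Finset.sum_add_distrib, Finset.sum_add_distrib, h2, Finset.sum_const, nsmul_eq_mul,
    mul_one] at h1
  linarith

theorem supp_subset_neighborFinset {C : (linkGraph G z).ConnectedComponent} {a : V}
    (ha : G.Adj z a) (haC : a ∈ C.supp) : C.supp.toFinset ⊆ G.neighborFinset z := by
  have h := supp_subset_of_closed C (T := {v | G.Adj z v}) (fun _ _ _ huv => huv.2.2) ha haC
  intro v hv
  rw [SimpleGraph.mem_neighborFinset]
  exact h (Set.mem_toFinset.1 hv)

/-- The components of the link of `z`. -/
noncomputable def linkComponents (G : SimpleGraph V) (z : V) :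
    Finset (linkGraph G z).ConnectedComponent :=
  (G.neighborFinset z).image (linkGraph G z).connectedComponentMk

theorem supp_subset_of_mem_linkComponents {C : (linkGraph G z).ConnectedComponent}
    (hC : C ∈ linkComponents G z) : C.supp.toFinset ⊆ G.neighborFinset z := by
  obtain ⟨a, ha, rfl⟩ := Finset.mem_image.1 hC
  exact supp_subset_neighborFinset ((SimpleGraph.mem_neighborFinset _ _ _).1 ha) rfl

theorem sum_linkComponents (f : V → ℝ) :
    ∑ C ∈ linkComponents G z, ∑ u ∈ C.supp.toFinset, f u = ∑ u ∈ G.neighborFinset z, f u := by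
  rw [← Finset.sum_fiberwise_of_maps_to
    (fun u hu => Finset.mem_image_of_mem (linkGraph G z).connectedComponentMk hu)]
  refine Finset.sum_congr rfl fun C hC => Finset.sum_congr ?_ fun _ _ => rfl
  ext v
  rw [Finset.mem_filter, Set.mem_toFinset]
  exact ⟨fun hv => ⟨supp_subset_of_mem_linkComponents hC (Set.mem_toFinset.2 hv), hv⟩,
    fun hv => hv.2⟩

theorem sum_biUnion_supp (P : Finset (linkGraph G z).ConnectedComponent) (f : V → ℝ) :
    ∑ u ∈ P.biUnion (fun C => C.supp.toFinset), f u = ∑ C ∈ P, ∑ u ∈ C.supp.toFinset, f u := by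
  refine Finset.sum_biUnion fun C _ D _ hCD => ?_
  rw [Function.onFun, Finset.disjoint_left]
  intro v hv hv'
  have h1 : v ∈ C.supp := Set.mem_toFinset.1 hv
  have h2 : v ∈ D.supp := Set.mem_toFinset.1 hv'
  exact hCD (h1.symm.trans h2)

/-- Components of positive excess force a large total cost. -/
theorem mul_sum_cost_ge (h : PerronData G z x r) {P : Finset (linkGraph G z).ConnectedComponent}
    (hP : P ⊆ linkComponents G z) {q : ℝ} (hq : 0 ≤ q)
    (hcard : ∀ C ∈ P, C.supp.toFinset.card ≤ 4)
    (hout : ∀ C ∈ P, r ≤ ∑ u ∈ C.supp.toFinset, outDeg G z u)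
    (hmiss : ∀ w ∈ far G z, q ≤ ∑ C ∈ P, missing G x C.supp.toFinset w) :
    q * (P.card * r) - 4 * P.card * ∑ w ∈ far G z, outDeg G z w ≤
      r * ∑ u ∈ G.neighborFinset z, cost G z x u := by
  set S := P.biUnion fun C => C.supp.toFinset with hS
  have hSU : S ⊆ G.neighborFinset z :=
    Finset.biUnion_subset.2 fun C hC => supp_subset_of_mem_linkComponents (hP hC)
  have hr : 0 ≤ r := by linarith [h.large]
  have h1 : ∑ u ∈ S, cost G z x u ≤ ∑ u ∈ G.neighborFinset z, cost G z x u :=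
    Finset.sum_le_sum_of_subset_of_nonneg hSU fun u _ _ => h.cost_nonneg u
  have h2 : ∀ w ∈ far G z, q - outDeg G z w ≤ r * (1 - x w) := fun w hw => by
    have := h.missing_le hSU hw
    have hm := hmiss w hw
    rw [show ∑ C ∈ P, missing G x C.supp.toFinset w = missing G x S w from
      (sum_biUnion_supp P _).symm] at hm
    linarith
  have h3 : ∑ u ∈ S, ∑ w ∈ far G z, ind G u w * (q - outDeg G z w) ≤
      r * ∑ u ∈ S, cost G z x u := by
    rw [Finset.mul_sum]
    refine Finset.sum_le_sum fun u _ => ?_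
    rw [cost, Finset.mul_sum]
    refine Finset.sum_le_sum fun w hw => ?_
    rw [mul_left_comm]
    exact mul_le_mul_of_nonneg_left (h2 w hw) (ind_nonneg _ _)
  have h4 : ∑ u ∈ S, ∑ w ∈ far G z, ind G u w * (q - outDeg G z w) =
      q * ∑ u ∈ S, outDeg G z u - ∑ w ∈ far G z, (∑ u ∈ S, ind G u w) * outDeg G z w := by
    simp only [mul_sub, Finset.sum_sub_distrib]
    congr 1
    · rw [Finset.mul_sum]
      exact Finset.sum_congr rfl fun u _ => by rw [← Finset.sum_mul, mul_comm, outDeg]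
    · rw [Finset.sum_comm]
      exact Finset.sum_congr rfl fun w _ => by rw [Finset.sum_mul]
  have h5 : P.card * r ≤ ∑ u ∈ S, outDeg G z u := by
    rw [hS, sum_biUnion_supp, ← nsmul_eq_mul]
    exact Finset.card_nsmul_le_sum _ _ _ hout
  have h6 : (S.card : ℝ) ≤ 4 * P.card := by
    have : S.card ≤ P.card * 4 := Finset.card_biUnion_le_card_mul _ _ _ hcard
    rw [mul_comm]
    exact_mod_cast this
  have h7 : ∑ w ∈ far G z, (∑ u ∈ S, ind G u w) * outDeg G z w ≤
      4 * P.card * ∑ w ∈ far G z, outDeg G z w := by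
    rw [Finset.mul_sum]
    refine Finset.sum_le_sum fun w _ => mul_le_mul_of_nonneg_right ?_ (outDeg_nonneg w)
    refine le_trans (le_trans (Finset.sum_le_sum fun u _ => ind_le_one u w) ?_) h6
    rw [Finset.sum_const, nsmul_eq_mul, mul_one]
  have h8 := mul_le_mul_of_nonneg_left h5 hq
  have h9 := mul_le_mul_of_nonneg_left h1 hr
  linarith

theorem outDeg_eq_zero_of_sum_lt_two (hsum : ∑ w ∈ far G z, outDeg G z w < 2) {w : V}
    (hw : w ∈ far G z) : outDeg G z w = 0 := by
  refine Finset.sum_eq_zero fun v hv => ?_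
  by_contra hne
  have hadj : G.Adj w v := by
    by_contra hn
    exact hne (ind_of_not_adj hn)
  have h1 : 1 ≤ outDeg G z w := by
    rw [← ind_of_adj hadj]
    exact Finset.single_le_sum (f := ind G w) (fun _ _ => ind_nonneg _ _) hv
  have h2 : 1 ≤ outDeg G z v := by
    rw [← ind_of_adj hadj.symm]
    exact Finset.single_le_sum (f := ind G v) (fun _ _ => ind_nonneg _ _) hw
  have h3 : ∑ y ∈ ({w, v} : Finset V), outDeg G z y ≤ ∑ y ∈ far G z, outDeg G z y :=
    Finset.sum_le_sum_of_subset_of_nonneg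
      (by intro y hy; rcases Finset.mem_insert.1 hy with rfl | hy
          · exact hw
          · rw [Finset.mem_singleton.1 hy]; exact hv) fun y _ _ => outDeg_nonneg y
  rw [Finset.sum_pair hadj.ne] at h3
  linarith

theorem sq_sub_self_le_of_exists_pos (h : PerronData G z x r)
    (hpos : ∃ C ∈ linkComponents G z, 0 < ∑ u ∈ C.supp.toFinset, excess G z x u) :
    r ^ 2 - r ≤ G.edgeFinset.card - 1 := by
  by_contra! hlt
  rw [h.sq_sub_self_eq] at hlt
  set e := (∑ w ∈ far G z, outDeg G z w) / 2 with he
  set K := ∑ u ∈ G.neighborFinset z, cost G z x u with hK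
  set P := (linkComponents G z).filter fun C => 0 < ∑ u ∈ C.supp.toFinset, excess G z x u with hP
  set Γ := ∑ C ∈ P, ∑ u ∈ C.supp.toFinset, excess G z x u with hΓ
  have hpiece : ∀ C ∈ P, C.supp.toFinset.card ≤ 4 ∧
      (∀ w ∈ far G z, ∑ u ∈ C.supp.toFinset, excess G z x u + 1 ≤
        missing G x C.supp.toFinset w) ∧ r ≤ ∑ u ∈ C.supp.toFinset, outDeg G z u := by
    intro C hC
    have hCpos := (Finset.mem_filter.1 hC).2
    rcases h.piece_supp C with h1 | ⟨u, -, h1⟩ | ⟨h1, h2, h3⟩ | ⟨h1, -⟩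
    · linarith
    · linarith [h.nonneg u]
    · exact ⟨h1, h2, h3 (by linarith)⟩
    · linarith
  have hΓle : ∑ u ∈ G.neighborFinset z, excess G z x u ≤ Γ := by
    rw [← sum_linkComponents, ← Finset.sum_filter_add_sum_filter_not _
      fun C => 0 < ∑ u ∈ C.supp.toFinset, excess G z x u]
    have : ∑ C ∈ (linkComponents G z).filter fun C => ¬ 0 < ∑ u ∈ C.supp.toFinset, excess G z x u,
        ∑ u ∈ C.supp.toFinset, excess G z x u ≤ 0 :=
      Finset.sum_nonpos fun C hC => not_lt.1 (Finset.mem_filter.1 hC).2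
    linarith
  have hΓ0 : 0 ≤ Γ := Finset.sum_nonneg fun C hC => (Finset.mem_filter.1 hC).2.le
  have hk : (1 : ℝ) ≤ P.card := by
    obtain ⟨C, hC, hCpos⟩ := hpos
    exact_mod_cast Finset.card_pos.2 ⟨C, Finset.mem_filter.2 ⟨hC, hCpos⟩⟩
  have hmain := h.mul_sum_cost_ge (P := P) (q := Γ + P.card) (Finset.filter_subset _ _)
    (by linarith) (fun C hC => (hpiece C hC).1) (fun C hC => (hpiece C hC).2.2) fun w hw => by
      have : ∑ C ∈ P, (∑ u ∈ C.supp.toFinset, excess G z x u + 1) ≤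
          ∑ C ∈ P, missing G x C.supp.toFinset w :=
        Finset.sum_le_sum fun C hC => (hpiece C hC).2.1 w hw
      rwa [Finset.sum_add_distrib, Finset.sum_const, nsmul_eq_mul, mul_one] at this
  rw [show ∑ w ∈ far G z, outDeg G z w = 2 * e by rw [he]; ring, ← hK] at hmain
  have he0 : 0 ≤ e := div_nonneg (Finset.sum_nonneg fun w _ => outDeg_nonneg w) (by norm_num)
  have hK0 : 0 ≤ K := Finset.sum_nonneg fun u _ => h.cost_nonneg u
  have hr := h.large
  set k : ℝ := (P.card : ℝ) with hkdef
  have h1 : r * (e + K) < r * (Γ + 1) := mul_lt_mul_of_pos_left (by linarith) (by linarith)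
  have h2 : Γ + 1 ≤ k * (Γ + k) := by
    have h3 : 0 ≤ (k - 1) * Γ := mul_nonneg (by linarith) hΓ0
    have h4 : 0 ≤ (k - 1) * k := mul_nonneg (by linarith) (by linarith)
    linarith
  have h3 : r * (Γ + 1) ≤ r * (k * (Γ + k)) := mul_le_mul_of_nonneg_left h2 (by linarith)
  rcases le_total (8 * k) r with hkr | hkr
  · have h4 : 0 ≤ (r - 8 * k) * e := mul_nonneg (by linarith) he0
    linarith
  · have h4 : 0 ≤ (8 * k - r) * (Γ + 1 - e) := mul_nonneg (by linarith) (by linarith)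
    have h5 : 8 * (k * (Γ + 1)) ≤ r * (k * (Γ + k)) :=
      mul_le_mul (by linarith) (mul_le_mul_of_nonneg_left (by linarith) (by linarith))
        (mul_nonneg (by linarith) (by linarith)) (by linarith)
    linarith

theorem sq_sub_self_le_of_forall_nonpos (h : PerronData G z x r)
    (hneg : ∀ C ∈ linkComponents G z, ∑ u ∈ C.supp.toFinset, excess G z x u ≤ 0) :
    r ^ 2 - r ≤ G.edgeFinset.card - 1 := by
  by_contra! hlt
  rw [h.sq_sub_self_eq] at hlt
  have hr := h.large
  have he0 : 0 ≤ ∑ w ∈ far G z, outDeg G z w := Finset.sum_nonneg fun w _ => outDeg_nonneg w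
  have hK0 : 0 ≤ ∑ u ∈ G.neighborFinset z, cost G z x u :=
    Finset.sum_nonneg fun u _ => h.cost_nonneg u
  have hle : ∀ C ∈ linkComponents G z, ∑ u ∈ G.neighborFinset z, excess G z x u ≤
      ∑ u ∈ C.supp.toFinset, excess G z x u := by
    intro C hC
    rw [← sum_linkComponents, ← Finset.add_sum_erase _ _ hC]
    have : ∑ D ∈ (linkComponents G z).erase C, ∑ u ∈ D.supp.toFinset, excess G z x u ≤ 0 :=
      Finset.sum_nonpos fun D hD => hneg D (Finset.mem_of_mem_erase hD)
    linarith
  have hcost : ∀ C ∈ linkComponents G z, ∑ u ∈ C.supp.toFinset, cost G z x u ≤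
      ∑ u ∈ G.neighborFinset z, cost G z x u := fun C hC =>
    Finset.sum_le_sum_of_subset_of_nonneg (supp_subset_of_mem_linkComponents hC)
      fun u _ _ => h.cost_nonneg u
  have hout : ∀ w ∈ far G z, outDeg G z w = 0 := by
    have : ∑ u ∈ G.neighborFinset z, excess G z x u ≤ 0 := by
      rw [← sum_linkComponents]
      exact Finset.sum_nonpos hneg
    exact fun w hw => outDeg_eq_zero_of_sum_lt_two (by linarith) hw
  by_cases hall : ∀ C ∈ linkComponents G z, ∑ u ∈ C.supp.toFinset, excess G z x u =
      ∑ u ∈ C.supp.toFinset, -x u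
  · have : ∑ u ∈ G.neighborFinset z, excess G z x u = -r := by
      rw [← sum_linkComponents, Finset.sum_congr rfl hall, sum_linkComponents,
        Finset.sum_neg_distrib, ← h.r_eq]
    linarith
  push Not at hall
  obtain ⟨C, hC, hne⟩ := hall
  have h1 := hle C hC
  have h2 := hcost C hC
  rcases h.piece_supp C with h3 | ⟨u, h3, h4⟩ | ⟨-, h3, h4⟩ | ⟨-, h3⟩
  · linarith
  · rw [h4, h3, Finset.sum_singleton] at hne
    exact hne rfl
  · set g := ∑ u ∈ C.supp.toFinset, excess G z x u with hg
    by_cases hg1 : -1 < g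
    · have h5 : ∀ u ∈ C.supp.toFinset, (g + 1) * outDeg G z u ≤ r * cost G z x u := fun u _ => by
        have := h.cost_lower (supp_subset_of_mem_linkComponents hC) hout ∅ (q := g + 1)
          (by linarith) u fun w hw _ _ => h3 w hw
        simpa using this
      have h6 := Finset.sum_le_sum h5
      rw [← Finset.mul_sum, ← Finset.mul_sum] at h6
      have h7 := mul_le_mul_of_nonneg_left (h4 hg1) (show 0 ≤ g + 1 by linarith)
      have h8 : r * (g + 1) ≤ r * ∑ u ∈ C.supp.toFinset, cost G z x u := by linarith
      have h9 := le_of_mul_le_mul_left h8 (by linarith)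
      linarith
    · linarith
  · have := h3 hout
    linarith

theorem sq_sub_self_le (h : PerronData G z x r) : r ^ 2 - r ≤ G.edgeFinset.card - 1 := by
  by_cases hpos : ∃ C ∈ linkComponents G z, 0 < ∑ u ∈ C.supp.toFinset, excess G z x u
  · exact h.sq_sub_self_le_of_exists_pos hpos
  · push Not at hpos
    exact h.sq_sub_self_le_of_forall_nonpos hpos

end PerronData

end Perron

theorem dotProduct_adjMatrix_mulVec_le_abs {V : Type*} [Fintype V] (G : SimpleGraph V)
    (y : V → ℝ) : y ⬝ᵥ (G.adjMatrix ℝ).mulVec y ≤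
      (fun v => |y v|) ⬝ᵥ (G.adjMatrix ℝ).mulVec fun v => |y v| := by
  simp only [dotProduct, Matrix.mulVec]
  refine Finset.sum_le_sum fun u _ => ?_
  rw [Finset.mul_sum, Finset.mul_sum]
  refine Finset.sum_le_sum fun v _ => ?_
  rw [SimpleGraph.adjMatrix_apply]
  split_ifs
  · rw [one_mul, one_mul, ← abs_mul]
    exact le_abs_self _
  · simp

/-- A weak form of the Perron–Frobenius theorem for adjacency matrices. -/
theorem exists_nonneg_eigenvector {V : Type*} [Fintype V] [Nonempty V] (G : SimpleGraph V) :
    ∃ (r : ℝ) (x : V → ℝ), (∀ v, 0 ≤ x v) ∧ x ≠ 0 ∧ (G.adjMatrix ℝ).mulVec x = r • x ∧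
      ∀ t, Module.End.HasEigenvalue (Matrix.toLin' (G.adjMatrix ℝ)) t → t ≤ r := by
  set A := G.adjMatrix ℝ with hA
  set K : Set (V → ℝ) := {x | (∀ v, 0 ≤ x v) ∧ x ⬝ᵥ x = 1} with hK
  have hcont : Continuous fun x : V → ℝ => x ⬝ᵥ A.mulVec x := by
    simp only [dotProduct, Matrix.mulVec]
    fun_prop
  have hcont' : Continuous fun x : V → ℝ => x ⬝ᵥ x := by
    simp only [dotProduct]
    fun_prop
  have hKc : IsCompact K := by
    refine (isCompact_univ_pi fun _ : V => isCompact_Icc (a := (0 : ℝ)) (b := 1)).of_isClosed_subset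
      ?_ fun x hx v _ => ⟨hx.1 v, ?_⟩
    · refine IsClosed.inter ?_ (isClosed_eq hcont' continuous_const)
      have : {x : V → ℝ | ∀ v, 0 ≤ x v} = ⋂ v, {x | 0 ≤ x v} := by ext; simp
      change IsClosed {x : V → ℝ | ∀ v, 0 ≤ x v}
      rw [this]
      exact isClosed_iInter fun v => isClosed_le continuous_const (continuous_apply v)
    · have h1 : x v * x v ≤ x ⬝ᵥ x :=
        Finset.single_le_sum (f := fun v => x v * x v) (fun _ _ => mul_self_nonneg _)
          (Finset.mem_univ v)
      rw [hx.2] at h1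
      nlinarith [hx.1 v]
  obtain ⟨v₀⟩ := ‹Nonempty V›
  have hKn : K.Nonempty := by
    refine ⟨Pi.single v₀ 1, fun v => ?_, by simp⟩
    by_cases hv : v = v₀
    · subst hv; simp
    · simp [hv]
  obtain ⟨x, hxK, hmax⟩ := hKc.exists_isMaxOn hKn hcont.continuousOn
  set r := x ⬝ᵥ A.mulVec x with hr
  have hpos : ∀ y : V → ℝ, y ≠ 0 → 0 < y ⬝ᵥ y := fun y hy =>
    lt_of_le_of_ne (Finset.sum_nonneg fun _ _ => mul_self_nonneg _)
      fun h0 => hy (dotProduct_self_eq_zero.1 h0.symm)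
  have hnn : ∀ y : V → ℝ, (∀ v, 0 ≤ y v) → y ⬝ᵥ A.mulVec y ≤ r * (y ⬝ᵥ y) := by
    intro y hy
    by_cases hy0 : y = 0
    · simp [hy0]
    have hs := hpos y hy0
    set c := (√(y ⬝ᵥ y))⁻¹ with hc
    have hcc : c * c * (y ⬝ᵥ y) = 1 := by
      rw [hc, ← mul_inv, Real.mul_self_sqrt hs.le, inv_mul_cancel₀ hs.ne']
    have hmem : c • y ∈ K := by
      refine ⟨fun v => mul_nonneg (inv_nonneg.2 (Real.sqrt_nonneg _)) (hy v), ?_⟩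
      rw [smul_dotProduct, dotProduct_smul, smul_eq_mul, smul_eq_mul, ← mul_assoc, hcc]
    have h1 : (c • y) ⬝ᵥ A.mulVec (c • y) ≤ r := hmax hmem
    rw [Matrix.mulVec_smul, smul_dotProduct, dotProduct_smul, smul_eq_mul, smul_eq_mul,
      ← mul_assoc] at h1
    calc y ⬝ᵥ A.mulVec y = c * c * (y ⬝ᵥ A.mulVec y) * (y ⬝ᵥ y) := by
          rw [mul_right_comm, hcc, one_mul]
      _ ≤ r * (y ⬝ᵥ y) := mul_le_mul_of_nonneg_right h1 hs.le
  have hall : ∀ y : V → ℝ, y ⬝ᵥ A.mulVec y ≤ r * (y ⬝ᵥ y) := by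
    intro y
    refine (dotProduct_adjMatrix_mulVec_le_abs G y).trans
      ((hnn (fun v => |y v|) fun v => abs_nonneg _).trans_eq ?_)
    simp [dotProduct]
  have hquad : ∀ y : V → ℝ, y ⬝ᵥ (r • (1 : Matrix V V ℝ) - A).mulVec y =
      r * (y ⬝ᵥ y) - y ⬝ᵥ A.mulVec y := by
    intro y
    rw [Matrix.sub_mulVec, dotProduct_sub, Matrix.smul_mulVec, Matrix.one_mulVec,
      dotProduct_smul, smul_eq_mul]
  have hpsd : (r • (1 : Matrix V V ℝ) - A).PosSemidef := by
    refine Matrix.PosSemidef.of_dotProduct_mulVec_nonneg ?_ fun y => ?_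
    · ext i j
      simp [hA, Matrix.one_apply, SimpleGraph.adjMatrix_apply, G.adj_comm, eq_comm]
    · rw [star_trivial, hquad]
      linarith [hall y]
  refine ⟨r, x, hxK.1, fun h0 => ?_, ?_, fun t ht => ?_⟩
  · have h1 := hxK.2
    simp [h0] at h1
  · have h1 := (hpsd.dotProduct_mulVec_zero_iff x).1 (by
      rw [star_trivial, hquad, hxK.2, mul_one, sub_self])
    rw [Matrix.sub_mulVec, Matrix.smul_mulVec, Matrix.one_mulVec, sub_eq_zero] at h1
    exact h1.symm
  · obtain ⟨y, hy⟩ := ht.exists_hasEigenvector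
    have h1 : A.mulVec y = t • y := by
      rw [← Matrix.toLin'_apply]
      exact hy.apply_eq_smul
    have h2 := hall y
    rw [h1, dotProduct_smul, smul_eq_mul] at h2
    exact le_of_mul_le_mul_right h2 (hpos y hy.2)

/-- The largest eigenvalue of an `F₆`-free graph with enough edges. -/
theorem F6Free.sq_sub_self_le {V : Type*} [Fintype V] {G : SimpleGraph V} (hG : F6Free G)
    (hm : 88 ≤ G.edgeFinset.card) {r : ℝ} {x : V → ℝ} (hx : ∀ v, 0 ≤ x v) (hx0 : x ≠ 0)
    (heig : (G.adjMatrix ℝ).mulVec x = r • x) : r ^ 2 - r ≤ G.edgeFinset.card - 1 := by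
  by_contra! hlt
  obtain ⟨v₀, hv₀⟩ := Function.ne_iff.1 hx0
  obtain ⟨z, -, hz⟩ := Finset.exists_max_image univ x ⟨v₀, mem_univ v₀⟩
  have hz0 : 0 < x z :=
    lt_of_lt_of_le (lt_of_le_of_ne (hx v₀) (Ne.symm hv₀)) (hz v₀ (mem_univ v₀))
  have heig' : ∀ v, r * x v = ∑ u, ind G v u * x u := fun v => by
    have h := congrFun heig v
    rw [Pi.smul_apply, smul_eq_mul] at h
    rw [← h, Matrix.mulVec, dotProduct]
    exact Finset.sum_congr rfl fun u _ => by rw [SimpleGraph.adjMatrix_apply, ind]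
  have hr0 : 0 ≤ r := by
    have h : 0 ≤ r * x z := by
      rw [heig' z]
      exact Finset.sum_nonneg fun u _ => mul_nonneg (ind_nonneg _ _) (hx u)
    exact nonneg_of_mul_nonneg_left h hz0
  have hr : 9.8 ≤ r := by
    have : (88 : ℝ) ≤ G.edgeFinset.card := by exact_mod_cast hm
    by_contra! hr
    nlinarith
  have hdata : PerronData G z (fun v => x v / x z) r :=
    { free := hG
      nonneg := fun v => div_nonneg (hx v) hz0.le
      le_one := fun v => (div_le_one hz0).2 (hz v (mem_univ v))
      root := div_self hz0.ne'
      eig := fun v => by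
        rw [mul_div_assoc', heig' v, Finset.sum_div]
        exact Finset.sum_congr rfl fun u _ => by rw [mul_div_assoc]
      large := hr }
  exact absurd hdata.sq_sub_self_le (not_le.2 hlt)

theorem stmt_2 {V : Type} [Fintype V] (G : SimpleGraph V) (m : ℕ) (hm : 88 ≤ m)
    (hfree : F6Free G) (hcard : G.edgeSet.ncard = m) :
    specRad G ≤ (1 + Real.sqrt (4 * (m : ℝ) - 3)) / 2 := by
  have hm' : G.edgeFinset.card = m := by
    rw [← hcard, ← SimpleGraph.coe_edgeFinset, Set.ncard_coe_finset]
  refine Real.sSup_le (fun t ht => ?_) (by positivity)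
  obtain ⟨y, hy⟩ := Module.End.HasEigenvalue.exists_hasEigenvector ht
  obtain ⟨v₀, -⟩ := Function.ne_iff.1 hy.2
  have : Nonempty V := ⟨v₀⟩
  obtain ⟨r, x, hx, hx0, heig, hmax⟩ := exists_nonneg_eigenvector G
  have h1 := hfree.sq_sub_self_le (by rw [hm']; exact hm) hx hx0 heig
  rw [hm'] at h1
  have h2 : 2 * r - 1 ≤ √(4 * (m : ℝ) - 3) := Real.le_sqrt_of_sq_le (by linarith)
  have h3 := hmax t ht
  linarith
end

section
/- Under the setup, the following inequality holds: Σ_{u∈U_+} (d_U(u)−1)·x_u/x_{u*} + Σ_{w∈W} d_U(w)·x_w/x_{u*} ≥ e(U_+) + e(U,W) + e(W) + Σ_{u∈U_0} x_u/x_{u*} − 1. -/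
open SimpleGraph Finset
open scoped Classical

/-- The edges at `u`, inside `A ⊆ N(u)`, between `N(u)` and the vertices outside `N[u]`, and among
those outside vertices are pairwise disjoint sets of edges. -/
lemma dS_add_eIn_add_eBetween_add_eIn_le {V : Type*} [Fintype V] (G : SimpleGraph V) (u : V)
    (A : Set V) (hA : A ⊆ G.neighborSet u) :
    dS G (G.neighborSet u) u + eIn G A
      + eBetween G (G.neighborSet u) ((insert u (G.neighborSet u))ᶜ)
      + eIn G ((insert u (G.neighborSet u))ᶜ) ≤ G.edgeSet.ncard := by
  have hd : dS G (G.neighborSet u) u = (G.incidenceSet u).ncard := by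
    rw [dS, Set.inter_self]
    exact (Set.ncard_congr' (G.incidenceSetEquivNeighborSet u)).symm
  rw [hd]
  unfold eIn eBetween
  set E₁ := {e ∈ G.edgeSet | ∀ v ∈ e, v ∈ A} with hE₁
  set E₂ := {e ∈ G.edgeSet | ∃ a ∈ G.neighborSet u, ∃ b ∈ (insert u (G.neighborSet u))ᶜ,
    e = s(a, b)} with hE₂
  set E₃ := {e ∈ G.edgeSet | ∀ v ∈ e, v ∈ (insert u (G.neighborSet u))ᶜ} with hE₃
  have h₁ : Disjoint (G.incidenceSet u) E₁ := by
    rw [Set.disjoint_left]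
    rintro e ⟨-, hu⟩ ⟨-, h⟩
    exact G.irrefl (hA (h u hu))
  have h₂ : Disjoint (G.incidenceSet u ∪ E₁) E₂ := by
    rw [Set.disjoint_left]
    rintro e he ⟨-, a, ha, b, hb, rfl⟩
    rcases he with ⟨-, hu⟩ | ⟨-, h⟩
    · rcases Sym2.mem_iff.1 hu with rfl | rfl
      · exact G.irrefl ha
      · exact hb (Set.mem_insert _ _)
    · exact hb (Set.mem_insert_of_mem _ (hA (h b (Sym2.mem_mk_right a b))))
  have h₃ : Disjoint (G.incidenceSet u ∪ E₁ ∪ E₂) E₃ := by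
    rw [Set.disjoint_left]
    rintro e he ⟨-, h'⟩
    rcases he with (⟨-, hu⟩ | ⟨-, h⟩) | ⟨-, a, ha, b, -, rfl⟩
    · exact h' u hu (Set.mem_insert _ _)
    · obtain ⟨v, hv⟩ : ∃ v, v ∈ e := ⟨_, e.out_fst_mem⟩
      exact h' v hv (Set.mem_insert_of_mem _ (hA (h v hv)))
    · exact h' a (Sym2.mem_mk_left a b) (Set.mem_insert_of_mem _ ha)
  rw [← Set.ncard_union_eq h₁, ← Set.ncard_union_eq h₂, ← Set.ncard_union_eq h₃]
  refine Set.ncard_le_ncard ?_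
  rintro e (((h | h) | h) | h) <;> exact h.1

/-- The eigenvalue equation applied twice at `u` counts the walks of length two from `u`. -/
lemma sq_mul_eq_sum_dS_mul {V : Type*} [Fintype V] (G : SimpleGraph V) [DecidableRel G.Adj]
    {lam : ℝ} {x : V → ℝ} (h : ∀ v, ∑ w ∈ G.neighborFinset v, x w = lam * x v) (u : V) :
    lam ^ 2 * x u = ∑ v, (dS G (G.neighborSet u) v : ℝ) * x v := by
  have hdS (v : V) : dS G (G.neighborSet u) v =
      ((G.neighborFinset u).filter (fun w => G.Adj w v)).card := by
    rw [dS, ← Set.ncard_coe_finset]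
    congr 1
    ext w
    simp [and_comm, G.adj_comm v w]
  calc lam ^ 2 * x u = ∑ w ∈ G.neighborFinset u, lam * x w := by
        rw [← mul_sum, h]; ring
    _ = ∑ w ∈ G.neighborFinset u, ∑ v, if G.Adj w v then x v else 0 := by
        refine sum_congr rfl fun w _ => ?_
        rw [← h, ← sum_filter, neighborFinset_eq_filter]
    _ = ∑ v, (dS G (G.neighborSet u) v : ℝ) * x v := by
        rw [sum_comm]
        refine sum_congr rfl fun v _ => ?_
        rw [← sum_filter, sum_const, nsmul_eq_mul, hdS]

theorem stmt_5 
    {V : Type} [Fintype V] [DecidableEq V] (G : SimpleGraph V) [DecidableRel G.Adj]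
    (m : ℕ) (hm : 88 ≤ m)
    (hfree : F6Free G)
    (hcard : G.edgeSet.ncard = m)
    (hnoiso : ∀ v : V, ∃ w, G.Adj v w)
    (hmax : ∀ (n : ℕ) (G' : SimpleGraph (Fin n)), F6Free G' → G'.edgeSet.ncard = m →
      (∀ v, ∃ w, G'.Adj v w) → specRad G' ≤ specRad G)
    (lam : ℝ) (hlam : lam = specRad G)
    (hconn : G.Connected)
    (hlow : (1 + Real.sqrt (4 * (m : ℝ) - 3)) / 2 ≤ lam)
    (x : V → ℝ) (hxpos : ∀ v, 0 < x v)
    (heig : (G.adjMatrix ℝ).mulVec x = lam • x)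
    (ustar : V) (hustar : ∀ v, x v ≤ x ustar)
    :
    (∑ u ∈ (G.neighborFinset ustar).filter (fun u => dS G (G.neighborSet ustar) u ≠ 0),
        ((dS G (G.neighborSet ustar) u : ℝ) - 1) * (x u / x ustar))
      + (∑ w ∈ Finset.univ \ insert ustar (G.neighborFinset ustar),
          (dS G (G.neighborSet ustar) w : ℝ) * (x w / x ustar))
    ≥ (eIn G (((G.neighborFinset ustar).filter
          (fun u => dS G (G.neighborSet ustar) u ≠ 0) : Finset V) : Set V) : ℝ)
        + (eBetween G (G.neighborSet ustar) ((insert ustar (G.neighborSet ustar))ᶜ) : ℝ)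
        + (eIn G ((insert ustar (G.neighborSet ustar))ᶜ) : ℝ)
        + (∑ u ∈ (G.neighborFinset ustar).filter
            (fun u => dS G (G.neighborSet ustar) u = 0), x u / x ustar)
        - 1 := by
  have hx₀ := hxpos ustar
  have hsum (v : V) : ∑ w ∈ G.neighborFinset v, x w = lam * x v := by
    simpa [adjMatrix_mulVec_apply] using congrFun heig v
  have hU := hsum ustar
  have hsq := sq_mul_eq_sum_dS_mul G hsum ustar
  have hedges := dS_add_eIn_add_eBetween_add_eIn_le G ustar
    (((G.neighborFinset ustar).filter
      (fun u => dS G (G.neighborSet ustar) u ≠ 0) : Finset V) : Set V)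
    (fun v hv => by simpa using (mem_filter.1 (mem_coe.1 hv)).1)
  rw [hcard] at hedges
  have hedges' := (Nat.cast_le (α := ℝ)).2 hedges
  simp only [Nat.cast_add] at hedges'
  have hlam_sq : (m : ℝ) - 1 ≤ lam ^ 2 - lam := by
    have hm' : (88 : ℝ) ≤ m := by exact_mod_cast hm
    have hs := Real.sq_sqrt (show (0 : ℝ) ≤ 4 * (m : ℝ) - 3 by linarith)
    nlinarith [Real.sqrt_nonneg (4 * (m : ℝ) - 3)]
  set d : V → ℕ := dS G (G.neighborSet ustar) with hd
  set U := G.neighborFinset ustar with hUdef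
  have hnot : ustar ∉ U := by simp [hUdef]
  rw [← sum_sdiff (subset_univ (insert ustar U)), sum_insert hnot] at hsq
  have hsplit : ∑ u ∈ U, (d u : ℝ) * x u - ∑ u ∈ U, x u =
      ∑ u ∈ U with d u ≠ 0, ((d u : ℝ) - 1) * x u - ∑ u ∈ U with d u = 0, x u := by
    have h₀ : ∑ u ∈ U with d u = 0, ((d u : ℝ) - 1) * x u = -∑ u ∈ U with d u = 0, x u := by
      rw [← sum_neg_distrib]
      refine sum_congr rfl fun u hu => ?_
      rw [(mem_filter.1 hu).2]
      simp
    have h := sum_filter_add_sum_filter_not U (fun u => d u = 0) (fun u => ((d u : ℝ) - 1) * x u)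
    rw [h₀] at h
    rw [← sum_sub_distrib, sum_congr rfl fun u _ => (sub_one_mul (d u : ℝ) (x u)).symm, ← h]
    ring
  simp only [← mul_div_assoc, ← sum_div]
  have key : (lam ^ 2 - lam - d ustar) * x ustar =
      ∑ u ∈ U with d u ≠ 0, ((d u : ℝ) - 1) * x u
        + ∑ w ∈ univ \ insert ustar U, (d w : ℝ) * x w - ∑ u ∈ U with d u = 0, x u := by
    linarith
  have key' := eq_div_of_mul_eq hx₀.ne' key
  rw [sub_div, add_div] at key'
  linarith
end

section
/- Under the setup, the number of edges inside the neighborhood of u* satisfies e(U) ≥ 4. Moreover e(U) > e(W) + 3. -/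
open SimpleGraph Finset
open scoped Classical

/-- Every edge meets a set `U` in at most one vertex unless it lies in `U`, so the degree sum
over `U` is controlled by the edges inside `U` and inside a set `W` disjoint from `U`. -/
theorem sum_degree_add_eIn_le {V : Type*} [Fintype V] [DecidableEq V] (G : SimpleGraph V)
    [DecidableRel G.Adj] (U : Finset V) (W : Set V) (hUW : ∀ v ∈ U, v ∉ W) :
    ∑ u ∈ U, G.degree u + eIn G W ≤ G.edgeSet.ncard + eIn G (U : Set V) := by
  have hin : ∀ S : Set V,
      eIn G S = ∑ e ∈ G.edgeFinset, if ∀ v ∈ e, v ∈ S then 1 else 0 := by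
    intro S
    rw [← Finset.card_filter, eIn, ← Set.ncard_coe_finset]
    congr 1
    ext e
    simp
  have hE : G.edgeSet.ncard = ∑ e ∈ G.edgeFinset, 1 := by
    rw [← Finset.card_eq_sum_ones, ← Set.ncard_coe_finset, coe_edgeFinset]
  have hdeg : ∑ u ∈ U, G.degree u = ∑ e ∈ G.edgeFinset, ∑ u ∈ U, if u ∈ e then 1 else 0 := by
    rw [Finset.sum_comm]
    refine Finset.sum_congr rfl fun u _ => ?_
    rw [← Finset.card_filter, ← G.card_incidenceFinset_eq_degree u]
    congr 1
    ext e
    simp [mem_incidenceFinset, incidenceSet]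
  rw [hdeg, hin, hin, hE, ← Finset.sum_add_distrib, ← Finset.sum_add_distrib]
  refine Finset.sum_le_sum fun e he => ?_
  induction e using Sym2.ind with
  | _ a b =>
    have hab : a ≠ b := by
      rintro rfl
      simp at he
    have hcount : (∑ u ∈ U, if u ∈ s(a, b) then 1 else 0)
        = (if a ∈ U then 1 else 0) + if b ∈ U then 1 else 0 := by
      rw [← Finset.sum_ite_eq' U a fun _ => 1, ← Finset.sum_ite_eq' U b fun _ => 1,
        ← Finset.sum_add_distrib]
      refine Finset.sum_congr rfl fun u _ => ?_
      simp only [Sym2.mem_iff]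
      grind
    rw [hcount]
    have ha := hUW a
    have hb := hUW b
    simp only [Sym2.mem_iff, forall_eq_or_imp, forall_eq, Finset.mem_coe]
    grind

/-- If an eigenvector attains a positive maximum at `u`, the square of its eigenvalue
is at most the number of walks of length two starting at `u`. -/
theorem sq_eigenvalue_le_sum_degree {V : Type*} [Fintype V] (G : SimpleGraph V)
    [DecidableRel G.Adj] {t : ℝ} {x : V → ℝ} (heig : (G.adjMatrix ℝ).mulVec x = t • x)
    {u : V} (hu : 0 < x u) (hmax : ∀ v, x v ≤ x u) :
    t ^ 2 ≤ ∑ v ∈ G.neighborFinset u, (G.degree v : ℝ) := by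
  have hsum : ∀ v, ∑ w ∈ G.neighborFinset v, x w = t * x v := by
    intro v
    rw [← adjMatrix_mulVec_apply, heig, Pi.smul_apply, smul_eq_mul]
  refine le_of_mul_le_mul_right ?_ hu
  calc t ^ 2 * x u = ∑ v ∈ G.neighborFinset u, ∑ w ∈ G.neighborFinset v, x w := by
        simp_rw [hsum, ← Finset.mul_sum, hsum]
        ring
    _ ≤ ∑ v ∈ G.neighborFinset u, (G.degree v : ℝ) * x u := by
        refine Finset.sum_le_sum fun v _ => ?_
        rw [← card_neighborFinset_eq_degree, ← nsmul_eq_mul]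
        exact Finset.sum_le_card_nsmul _ _ _ fun w _ => hmax w
    _ = _ := by rw [Finset.sum_mul]

theorem stmt_6 
    {V : Type} [Fintype V] [DecidableEq V] (G : SimpleGraph V) [DecidableRel G.Adj]
    (m : ℕ) (hm : 88 ≤ m)
    (hfree : F6Free G)
    (hcard : G.edgeSet.ncard = m)
    (hnoiso : ∀ v : V, ∃ w, G.Adj v w)
    (hmax : ∀ (n : ℕ) (G' : SimpleGraph (Fin n)), F6Free G' → G'.edgeSet.ncard = m →
      (∀ v, ∃ w, G'.Adj v w) → specRad G' ≤ specRad G)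
    (lam : ℝ) (hlam : lam = specRad G)
    (hconn : G.Connected)
    (hlow : (1 + Real.sqrt (4 * (m : ℝ) - 3)) / 2 ≤ lam)
    (x : V → ℝ) (hxpos : ∀ v, 0 < x v)
    (heig : (G.adjMatrix ℝ).mulVec x = lam • x)
    (ustar : V) (hustar : ∀ v, x v ≤ x ustar)
    :
    4 ≤ eIn G (G.neighborSet ustar) ∧
    eIn G ((insert ustar (G.neighborSet ustar))ᶜ) + 3 < eIn G (G.neighborSet ustar) := by
  have hsq := sq_eigenvalue_le_sum_degree G heig (hxpos ustar) hustar
  have hcount := sum_degree_add_eIn_le G (G.neighborFinset ustar)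
    ((insert ustar (G.neighborSet ustar))ᶜ) fun v hv => by
      rw [mem_neighborFinset] at hv
      simp [hv]
  rw [coe_neighborFinset, hcard] at hcount
  have hcount' : (∑ v ∈ G.neighborFinset ustar, (G.degree v : ℝ))
      + eIn G ((insert ustar (G.neighborSet ustar))ᶜ) ≤ m + eIn G (G.neighborSet ustar) := by
    exact_mod_cast hcount
  have hm' : (88 : ℝ) ≤ m := by exact_mod_cast hm
  have hs : √(4 * (m : ℝ) - 3) ^ 2 = 4 * m - 3 := Real.sq_sqrt (by linarith)
  have hs9 : (9 : ℝ) ≤ √(4 * (m : ℝ) - 3) := Real.le_sqrt_of_sq_le (by linarith)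
  have hlam5 : 5 ≤ lam := by linarith
  have hlamsq : (m : ℝ) - 1 + lam ≤ lam ^ 2 := by nlinarith
  have key : eIn G ((insert ustar (G.neighborSet ustar))ᶜ) + 3 < eIn G (G.neighborSet ustar) := by
    have : (eIn G ((insert ustar (G.neighborSet ustar))ᶜ) : ℝ) + 3
        < eIn G (G.neighborSet ustar) := by linarith
    exact_mod_cast this
  exact ⟨by omega, key⟩
end
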